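/- For every n ≥ 4, the geometric realization of the pure discrete Morse complex M_p(C_n) of the cycle graph C_n on n nodes is homotopy equivalent to the wedge S^2 ∨ S^{n−2} ∨ S^{n−2}. -/

import Mathlib

open Finset

/-- Arc of the Hasse diagram of the simplicial complex `K`: from `g` to `f` whenever
`f ⊂ g` and `dim g = dim f + 1`. -/
def HasseArc {V : Type} [DecidableEq V] (K : Finset (Finset V)) (g f : Finset V) : Prop :=
  g ∈ K ∧ f ∈ K ∧ f ⊂ g ∧ g.card = f.card + 1

/-- `M` is a matching: no two distinct pairs of `M` share an endpoint. -/
def IsMatchingPairs {α : Type} (M : Set (α × α)) : Prop :=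
  ∀ p ∈ M, ∀ q ∈ M, p ≠ q → p.1 ≠ q.1 ∧ p.1 ≠ q.2 ∧ p.2 ≠ q.1 ∧ p.2 ≠ q.2

/-- One step of the Hasse diagram of `K` with the arcs belonging to `M` reversed. -/
def MorseStep {V : Type} [DecidableEq V] (K : Finset (Finset V))
    (M : Set (Finset V × Finset V)) (x y : Finset V) : Prop :=
  (HasseArc K x y ∧ (x, y) ∉ M) ∨ ((y, x) ∈ M ∧ HasseArc K y x)

/-- A (discrete) Morse matching on the complex `K`: a matching in the Hasse diagram of `K`
such that reversing exactly the arcs of the matching yields a directed graph with no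
directed cycle. -/
def IsMorseMatching {V : Type} [DecidableEq V] (K : Finset (Finset V))
    (M : Set (Finset V × Finset V)) : Prop :=
  (∀ p ∈ M, HasseArc K p.1 p.2) ∧ IsMatchingPairs M ∧
    ∀ s : Finset V, ¬ Relation.TransGen (MorseStep K M) s s

/-- A finite graph regarded as a one-dimensional simplicial complex: faces are the
vertices (as singletons) and the edges (as two-element sets). -/
noncomputable def graphComplex {V : Type} [Fintype V] [DecidableEq V] (G : SimpleGraph V) :
    Finset (Finset V) := by
  classical
  exact Finset.univ.filter fun s => (∃ v, s = {v}) ∨ ∃ u v, G.Adj u v ∧ s = {u, v}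

open Finset

/-- A finite abstract simplicial complex: a collection of nonempty finite sets closed
under taking nonempty subsets. -/
def IsComplex {V : Type} (K : Finset (Finset V)) : Prop :=
  ∀ s ∈ K, s.Nonempty ∧ ∀ t, t ⊆ s → t.Nonempty → t ∈ K

/-- Geometric realization of the finite abstract simplicial complex `K`, as a subspace of
`V → ℝ`: the convex combinations of vertices whose support is a face of `K`. -/
def realization {V : Type} [Fintype V] (K : Finset (Finset V)) : Set (V → ℝ) :=
  {x | (∀ v, 0 ≤ x v) ∧ (∑ v, x v) = 1 ∧ ∃ s ∈ K, ∀ v, x v ≠ 0 ↔ v ∈ s}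

lemma realization_mono {V : Type} [Fintype V] {K L : Finset (Finset V)} (h : K ⊆ L) :
    realization K ⊆ realization L := by
  rintro x ⟨h0, h1, s, hs, hsupp⟩
  exact ⟨h0, h1, s, h hs, hsupp⟩

/-- The inclusion map between geometric realizations induced by an inclusion of complexes. -/
def inclMap {V : Type} [Fintype V] {K L : Finset (Finset V)} (h : K ⊆ L) :
    C(↥(realization K), ↥(realization L)) :=
  ⟨Set.inclusion (realization_mono h), continuous_inclusion (realization_mono h)⟩

/-- The unreduced suspension of a topological space `X`: the quotient of `X × [0,1]`
collapsing `X × {0}` to a point and `X × {1}` to a point. -/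
def Susp (X : Type) [TopologicalSpace X] : Type :=
  Quot fun p q : X × unitInterval => p.2 = q.2 ∧ (p.2 = 0 ∨ p.2 = 1)

instance (X : Type) [TopologicalSpace X] : TopologicalSpace (Susp X) :=
  inferInstanceAs (TopologicalSpace (Quot _))

/-- The wedge (one-point union) of three pointed spaces: the disjoint union with the three
base points identified. -/
def Wedge3 (X Y Z : Type) [TopologicalSpace X] [TopologicalSpace Y] [TopologicalSpace Z]
    (x₀ : X) (y₀ : Y) (z₀ : Z) : Type :=
  Quot fun u v : X ⊕ Y ⊕ Z =>
    (u = Sum.inl x₀ ∧ v = Sum.inr (Sum.inl y₀)) ∨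
    (u = Sum.inl x₀ ∧ v = Sum.inr (Sum.inr z₀))

instance (X Y Z : Type) [TopologicalSpace X] [TopologicalSpace Y] [TopologicalSpace Z]
    (x₀ : X) (y₀ : Y) (z₀ : Z) : TopologicalSpace (Wedge3 X Y Z x₀ y₀ z₀) :=
  inferInstanceAs (TopologicalSpace (Quot _))

/-- The `k`-dimensional sphere, as a type. -/
noncomputable def NSphere (k : ℕ) : Type :=
  ↥(Metric.sphere (0 : EuclideanSpace ℝ (Fin (k + 1))) 1)

noncomputable instance (k : ℕ) : TopologicalSpace (NSphere k) :=
  inferInstanceAs (TopologicalSpace ↥(Metric.sphere (0 : EuclideanSpace ℝ (Fin (k + 1))) 1))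

/-- The discrete Morse complex of the complex `K`: its faces are the nonempty Morse
matchings on `K`. -/
noncomputable def morseComplex {V : Type} [Fintype V] [DecidableEq V]
    (K : Finset (Finset V)) : Finset (Finset (Finset V × Finset V)) := by
  classical
  exact Finset.univ.filter fun M => M.Nonempty ∧ IsMorseMatching K ↑M

/-- The pure discrete Morse complex of `K`: the subcomplex of the discrete Morse complex
generated by its faces of maximal dimension. -/
noncomputable def pureMorseComplex {V : Type} [Fintype V] [DecidableEq V]
    (K : Finset (Finset V)) : Finset (Finset (Finset V × Finset V)) := by
  classical
  exact Finset.univ.filter fun M => M.Nonempty ∧ ∃ M' ∈ morseComplex K,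
    (∀ N ∈ morseComplex K, N.card ≤ M'.card) ∧ M ⊆ M'

/-! ### Realizations of abstract simplicial complexes and collapses -/

section Collapse

variable {V : Type}

/-- `x` lies in the closed simplex spanned by `s`. -/
def InSimplex (s : Finset V) (x : V → ℝ) : Prop :=
  (∀ v, 0 ≤ x v) ∧ (∀ v, v ∉ s → x v = 0) ∧ ∑ v ∈ s, x v = 1

/-- The union of the closed simplices spanned by the members of `K`. -/
def geom (K : Set (Finset V)) : Set (V → ℝ) := {x | ∃ s ∈ K, InSimplex s x}

/-- `K` is closed under passing to nonempty subsets. -/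
def DownClosed (K : Set (Finset V)) : Prop :=
  ∀ s ∈ K, ∀ t, t ⊆ s → t.Nonempty → t ∈ K

lemma InSimplex.mono {s t : Finset V} {x : V → ℝ} (h : InSimplex s x) (hst : s ⊆ t) :
    InSimplex t x :=
  ⟨h.1, fun v hv => h.2.1 v fun hvs => hv (hst hvs), by
    rw [← h.2.2]; exact (sum_subset hst fun v _ hv => h.2.1 v hv).symm⟩

lemma InSimplex.erase [DecidableEq V] {s : Finset V} {x : V → ℝ} (h : InSimplex s x) {v : V}
    (hv : x v = 0) :
    InSimplex (s.erase v) x := by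
  refine ⟨h.1, fun u hu => ?_, ?_⟩
  · by_cases huv : u = v
    · rw [huv, hv]
    · exact h.2.1 u fun hus => hu (mem_erase.2 ⟨huv, hus⟩)
  · rw [← h.2.2]; exact sum_erase _ hv

lemma InSimplex.nonempty {s : Finset V} {x : V → ℝ} (h : InSimplex s x) : s.Nonempty := by
  rw [nonempty_iff_ne_empty]
  rintro rfl
  simpa using h.2.2

lemma InSimplex.convex {s : Finset V} {x y : V → ℝ} (hx : InSimplex s x) (hy : InSimplex s y)
    {t : ℝ} (h0 : 0 ≤ t) (h1 : t ≤ 1) : InSimplex s (fun v => (1 - t) * x v + t * y v) := by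
  refine ⟨fun v => ?_, fun v hv => ?_, ?_⟩
  · have := hx.1 v
    have := hy.1 v
    have : 0 ≤ 1 - t := by linarith
    positivity
  · simp [hx.2.1 v hv, hy.2.1 v hv]
  · rw [sum_add_distrib, ← mul_sum, ← mul_sum, hx.2.2, hy.2.2]; ring

/-- Two maps into a complex are homotopic if they are pointwise in a common simplex. -/
lemma homotopic_of_common_simplex {Y : Type} [TopologicalSpace Y] {K : Set (Finset V)}
    (f g : C(Y, geom K))
    (h : ∀ y, ∃ s ∈ K, InSimplex s (f y : V → ℝ) ∧ InSimplex s (g y : V → ℝ)) :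
    ContinuousMap.Homotopic f g := by
  refine ⟨⟨⟨fun p => ⟨fun v => (1 - (p.1 : ℝ)) * (f p.2 : V → ℝ) v +
    (p.1 : ℝ) * (g p.2 : V → ℝ) v, ?_⟩, ?_⟩, ?_, ?_⟩⟩
  · obtain ⟨s, hs, hf, hg⟩ := h p.2
    exact ⟨s, hs, hf.convex hg p.1.2.1 p.1.2.2⟩
  · refine Continuous.subtype_mk (continuous_pi fun v => ?_) _
    have hf : Continuous fun p : unitInterval × Y => (f p.2 : V → ℝ) v :=
      (continuous_apply v).comp (continuous_subtype_val.comp (f.continuous.comp continuous_snd))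
    have hg : Continuous fun p : unitInterval × Y => (g p.2 : V → ℝ) v :=
      (continuous_apply v).comp (continuous_subtype_val.comp (g.continuous.comp continuous_snd))
    have ht : Continuous fun p : unitInterval × Y => (p.1 : ℝ) :=
      continuous_subtype_val.comp continuous_fst
    exact ((continuous_const.sub ht).mul hf).add (ht.mul hg)
  · intro y; ext v; simp
  · intro y; ext v; simp

/-- The smallest coordinate of `x` on `σ`. -/
noncomputable def minCoord (σ : Finset V) (hσ : σ.Nonempty) (x : V → ℝ) : ℝ :=
  σ.inf' hσ x

lemma continuous_minCoord (σ : Finset V) (hσ : σ.Nonempty) : Continuous (minCoord σ hσ) :=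
  Continuous.finset_inf'_apply hσ fun v _ => continuous_apply v

lemma minCoord_le {σ : Finset V} (hσ : σ.Nonempty) (x : V → ℝ) {v : V} (hv : v ∈ σ) :
    minCoord σ hσ x ≤ x v := inf'_le _ hv

lemma minCoord_nonneg {σ : Finset V} (hσ : σ.Nonempty) {x : V → ℝ} (hx : ∀ v, 0 ≤ x v) :
    0 ≤ minCoord σ hσ x := le_inf' _ _ fun v _ => hx v

lemma exists_minCoord_eq {σ : Finset V} (hσ : σ.Nonempty) (x : V → ℝ) :
    ∃ v ∈ σ, x v = minCoord σ hσ x := by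
  obtain ⟨v, hv, h⟩ := exists_mem_eq_inf' hσ x
  exact ⟨v, hv, h.symm⟩

lemma minCoord_eq_zero {σ s : Finset V} (hσ : σ.Nonempty) {x : V → ℝ} (hx : InSimplex s x)
    (h : ¬ σ ⊆ s) : minCoord σ hσ x = 0 := by
  obtain ⟨v, hv, hvs⟩ := not_subset.1 h
  exact le_antisymm ((minCoord_le hσ x hv).trans_eq (hx.2.1 v hvs)) (minCoord_nonneg hσ hx.1)

variable [DecidableEq V]

/-- The map pushing the open star of `σ` away from `σ` towards the vertex `w`. -/
noncomputable def pushAway (σ : Finset V) (hσ : σ.Nonempty) (w : V) (x : V → ℝ) : V → ℝ :=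
  fun v => x v + minCoord σ hσ x * ((if v = w then (σ.card : ℝ) else 0) - if v ∈ σ then 1 else 0)

lemma continuous_pushAway (σ : Finset V) (hσ : σ.Nonempty) (w : V) :
    Continuous (pushAway σ hσ w) := by
  refine continuous_pi fun v => ?_
  exact (continuous_apply v).add ((continuous_minCoord σ hσ).mul continuous_const)

lemma pushAway_inSimplex {σ t : Finset V} (hσ : σ.Nonempty) {w : V} (hw : w ∉ σ) (hwt : w ∈ t)
    (hσt : σ ⊆ t) {x : V → ℝ} (hx : InSimplex t x) : InSimplex t (pushAway σ hσ w x) := by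
  have hm := minCoord_nonneg hσ hx.1
  refine ⟨fun v => ?_, fun v hv => ?_, ?_⟩
  · unfold pushAway
    by_cases hv : v ∈ σ
    · have hvw : v ≠ w := fun h => hw (h ▸ hv)
      have := minCoord_le hσ x hv
      simp only [hv, hvw, if_true, if_false]; linarith
    · have := hx.1 v
      simp only [hv, if_false, sub_zero]
      split_ifs <;> positivity
  · have h1 : v ≠ w := fun h => hv (h ▸ hwt)
    have h2 : v ∉ σ := fun h => hv (hσt h)
    simp [pushAway, h1, h2, hx.2.1 v hv]
  · simp only [pushAway]
    rw [sum_add_distrib, hx.2.2, ← mul_sum, sum_sub_distrib, sum_ite_eq' t w, if_pos hwt,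
      ← sum_filter, filter_mem_eq_inter, inter_eq_right.2 hσt]
    simp

lemma pushAway_eq_self {σ s : Finset V} (hσ : σ.Nonempty) (w : V) {x : V → ℝ}
    (hx : InSimplex s x) (h : ¬ σ ⊆ s) : pushAway σ hσ w x = x := by
  funext v; simp [pushAway, minCoord_eq_zero hσ hx h]

/-- `L` arises from `K` by removing the open star of a face `σ` whose link is a cone. -/
def CollapseStep (K L : Set (Finset V)) : Prop :=
  ∃ (σ : Finset V) (w : V), σ.Nonempty ∧ w ∉ σ ∧ (∀ s ∈ K, σ ⊆ s → insert w s ∈ K) ∧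
    L = {s ∈ K | ¬ σ ⊆ s}

/-- `L` arises from `K` by a sequence of collapses. -/
abbrev Collapses (K L : Set (Finset V)) : Prop := Relation.ReflTransGen CollapseStep K L

lemma CollapseStep.downClosed {K L : Set (Finset V)} (h : CollapseStep K L)
    (hK : DownClosed K) : DownClosed L := by
  obtain ⟨σ, w, -, -, -, rfl⟩ := h
  exact fun s hs t hts ht => ⟨hK s hs.1 t hts ht, fun h => hs.2 (h.trans hts)⟩

lemma CollapseStep.homotopyEquiv {K L : Set (Finset V)} (h : CollapseStep K L)
    (hK : DownClosed K) : Nonempty (ContinuousMap.HomotopyEquiv (geom K) (geom L)) := by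
  obtain ⟨σ, w, hσ, hw, hcone, rfl⟩ := h
  have hmem : ∀ x ∈ geom K, pushAway σ hσ w x ∈ geom {s ∈ K | ¬ σ ⊆ s} := by
    rintro x ⟨s, hs, hx⟩
    by_cases h : σ ⊆ s
    · have hx' := hx.mono (subset_insert w s)
      have hin := pushAway_inSimplex hσ hw (mem_insert_self w s)
        (h.trans (subset_insert w s)) hx'
      obtain ⟨v, hv, hxv⟩ := exists_minCoord_eq hσ x
      have hvw : v ≠ w := fun h => hw (h ▸ hv)
      have hzero : pushAway σ hσ w x v = 0 := by simp [pushAway, hv, hvw, hxv]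
      refine ⟨_, ⟨hK _ (hcone s hs h) _ (erase_subset v _) (hin.erase hzero).nonempty, ?_⟩,
        hin.erase hzero⟩
      exact fun hsub => notMem_erase v _ (hsub hv)
    · rw [pushAway_eq_self hσ w hx h]
      exact ⟨s, ⟨hs, h⟩, hx⟩
  let r : C(geom K, geom {s ∈ K | ¬ σ ⊆ s}) :=
    ⟨fun x => ⟨pushAway σ hσ w x, hmem x x.2⟩,
      ((continuous_pushAway σ hσ w).comp continuous_subtype_val).subtype_mk _⟩
  have hsub : geom {s ∈ K | ¬ σ ⊆ s} ⊆ geom K := fun x ⟨s, hs, hx⟩ => ⟨s, hs.1, hx⟩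
  let i : C(geom {s ∈ K | ¬ σ ⊆ s}, geom K) := ⟨Set.inclusion hsub, continuous_inclusion hsub⟩
  refine ⟨⟨r, i, ?_, ?_⟩⟩
  · refine homotopic_of_common_simplex _ _ fun x => ?_
    obtain ⟨s, hs, hx⟩ := x.2
    by_cases h : σ ⊆ s
    · refine ⟨insert w s, hcone s hs h, ?_, hx.mono (subset_insert w s)⟩
      exact pushAway_inSimplex hσ hw (mem_insert_self w s) (h.trans (subset_insert w s))
        (hx.mono (subset_insert w s))
    · refine ⟨s, hs, ?_, hx⟩
      change InSimplex s (pushAway σ hσ w x)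
      rwa [pushAway_eq_self hσ w hx h]
  · have : r.comp i = ContinuousMap.id _ := by
      ext x : 2
      obtain ⟨s, hs, hx⟩ := x.2
      exact pushAway_eq_self hσ w hx hs.2
    rw [this]

lemma Collapses.homotopyEquiv {K L : Set (Finset V)} (h : Collapses K L)
    (hK : DownClosed K) : Nonempty (ContinuousMap.HomotopyEquiv (geom K) (geom L)) := by
  suffices DownClosed L ∧ Nonempty (ContinuousMap.HomotopyEquiv (geom K) (geom L)) from this.2
  induction h with
  | refl => exact ⟨hK, ⟨.refl _⟩⟩
  | tail _ hstep ih =>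
    obtain ⟨hL, ⟨e⟩⟩ := ih
    obtain ⟨e'⟩ := hstep.homotopyEquiv hL
    exact ⟨hstep.downClosed hL, ⟨e.trans e'⟩⟩

lemma Collapses.single {K : Set (Finset V)} {σ : Finset V} {w : V} (hσ : σ.Nonempty)
    (hw : w ∉ σ) (h : ∀ s ∈ K, σ ⊆ s → insert w s ∈ K) : Collapses K {s ∈ K | ¬ σ ⊆ s} :=
  Relation.ReflTransGen.single ⟨σ, w, hσ, hw, h, rfl⟩

/-- Simultaneous removal of the open stars of a family of faces. -/
lemma Collapses.family {ι : Type} (K : Set (Finset V)) (T : Finset ι) (σ : ι → Finset V)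
    (w : ι → V) (hσ : ∀ i ∈ T, (σ i).Nonempty) (hw : ∀ i ∈ T, w i ∉ σ i)
    (hcone : ∀ i ∈ T, ∀ s ∈ K, σ i ⊆ s → insert (w i) s ∈ K)
    (hindep : ∀ i ∈ T, ∀ j ∈ T, ∀ s ∈ K, σ i ⊆ s → σ j ⊆ insert (w i) s → σ j ⊆ s) :
    Collapses K {s ∈ K | ∀ i ∈ T, ¬ σ i ⊆ s} := by
  classical
  induction T using Finset.induction_on with
  | empty => simpa using Relation.ReflTransGen.refl
  | insert i T hi ih =>
    refine (ih (fun j hj => hσ j (mem_insert_of_mem hj)) (fun j hj => hw j (mem_insert_of_mem hj))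
      (fun j hj => hcone j (mem_insert_of_mem hj)) fun j hj k hk =>
        hindep j (mem_insert_of_mem hj) k (mem_insert_of_mem hk)).tail
      ⟨σ i, w i, hσ i (mem_insert_self i T), hw i (mem_insert_self i T), ?_, ?_⟩
    · rintro s ⟨hs, hsT⟩ his
      refine ⟨hcone i (mem_insert_self i T) s hs his, fun j hj hji => hsT j hj ?_⟩
      exact hindep i (mem_insert_self i T) j (mem_insert_of_mem hj) s hs his hji
    · ext s
      simp only [Set.mem_ofPred_eq, forall_mem_insert]
      tauto

/-- The complex obtained from `K` by attaching a cone with apex `p` over `C`. -/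
def attachCone (K C : Set (Finset V)) (p : V) : Set (Finset V) :=
  {s | (p ∉ s ∧ s ∈ K) ∨ (p ∈ s ∧ (s = {p} ∨ s.erase p ∈ C))}

lemma Collapses.attachCone {C D : Set (Finset V)} (h : Collapses C D) (K : Set (Finset V))
    {p : V} (hp : ∀ s ∈ C, p ∉ s) : Collapses (attachCone K C p) (attachCone K D p) := by
  suffices (∀ s ∈ D, p ∉ s) ∧ Collapses (_root_.attachCone K C p) (_root_.attachCone K D p)
    from this.2
  induction h with
  | refl => exact ⟨hp, .refl⟩
  | @tail D D' _ hstep ih =>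
    obtain ⟨hD, ih⟩ := ih
    obtain ⟨σ, w, hσ, hw, hcone, rfl⟩ := hstep
    refine ⟨fun s hs => hD s hs.1, ?_⟩
    by_cases hpσ : p ∈ σ
    · have : {s ∈ D | ¬ σ ⊆ s} = D := by
        ext s
        simp only [Set.mem_ofPred_eq, and_iff_left_iff_imp]
        exact fun hs h => hD s hs (h hpσ)
      rwa [this]
    have hne : ∀ {s}, s = {p} → ¬ insert p σ ⊆ s := by
      rintro s rfl h
      obtain ⟨v, hv⟩ := hσ
      have := h (mem_insert_of_mem hv)
      rw [mem_singleton] at this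
      exact hpσ (this ▸ hv)
    have hiff : ∀ {s : Finset V}, p ∈ s → (insert p σ ⊆ s ↔ σ ⊆ s.erase p) := by
      intro s hs
      rw [insert_subset_iff, subset_erase]
      tauto
    by_cases hwp : w = p
    · have : ∀ s ∈ D, ¬ σ ⊆ s := fun s hs h =>
        hD _ (hcone s hs h) (hwp ▸ mem_insert_self w s)
      have : {s ∈ D | ¬ σ ⊆ s} = D := by
        ext s
        simp only [Set.mem_ofPred_eq, and_iff_left_iff_imp]
        exact this s
      rwa [this]
    refine ih.tail ⟨insert p σ, w, insert_nonempty _ _, by simp [hw, hwp], ?_, ?_⟩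
    · rintro s hs hsub
      have hps : p ∈ s := hsub (mem_insert_self p σ)
      rcases hs with ⟨h, -⟩ | ⟨-, h | h⟩
      · exact absurd hps h
      · exact absurd hsub (hne h)
      · refine Or.inr ⟨mem_insert_of_mem hps, Or.inr ?_⟩
        rw [erase_insert_of_ne hwp]
        exact hcone _ h ((hiff hps).1 hsub)
    · ext s
      simp only [_root_.attachCone, Set.mem_ofPred_eq]
      constructor
      · rintro (h | ⟨hps, h | h⟩)
        · exact ⟨Or.inl h, fun hsub => h.1 (hsub (mem_insert_self p σ))⟩
        · exact ⟨Or.inr ⟨hps, Or.inl h⟩, hne h⟩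
        · exact ⟨Or.inr ⟨hps, Or.inr h.1⟩, fun hsub => h.2 ((hiff hps).1 hsub)⟩
      · rintro ⟨h | ⟨hps, h | h⟩, hsub⟩
        · exact Or.inl h
        · exact Or.inr ⟨hps, Or.inl h⟩
        · exact Or.inr ⟨hps, Or.inr ⟨h, fun h' => hsub ((hiff hps).2 h')⟩⟩

/-- Attaching a cone over a subcomplex that collapses to a vertex can be undone by collapses. -/
lemma collapses_of_attachCone {K C : Set (Finset V)} {p c : V} (hpc : p ≠ c)
    (hK : ∀ s ∈ K, p ∉ s) (hC : ∀ s ∈ C, p ∉ s) (h : Collapses C {{c}}) :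
    Collapses (attachCone K C p) K := by
  refine (h.attachCone K hC).tail ⟨{p}, c, singleton_nonempty _, by simpa using hpc.symm, ?_, ?_⟩
  · rintro s (⟨h, -⟩ | ⟨hps, h⟩) hsub
    · exact absurd (hsub (mem_singleton_self p)) h
    · refine Or.inr ⟨mem_insert_of_mem hps, Or.inr ?_⟩
      rw [Set.mem_singleton_iff]
      rcases h with rfl | h
      · ext v; simp; grind
      · rw [Set.mem_singleton_iff] at h
        ext v
        have := congrArg (v ∈ ·) h
        simp at this ⊢
        grind
  · ext s
    simp only [attachCone, Set.mem_ofPred_eq, singleton_subset_iff]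
    constructor
    · exact fun hs => ⟨Or.inl ⟨hK s hs, hs⟩, hK s hs⟩
    · rintro ⟨h | h, hs⟩
      · exact h.2
      · exact absurd h.1 hs

end Collapse

/-! ### Boundaries of simplices are spheres -/

section Sphere

/-- The boundary of the standard simplex with `k + 2` vertices. -/
def stdBoundary (k : ℕ) : Set (Fin (k + 2) → ℝ) :=
  {u | (∀ i, 0 ≤ u i) ∧ ∑ i, u i = 1 ∧ ∃ i, u i = 0}

lemma exists_sphere_param_stdBoundary (k : ℕ) :
    ∃ h : NSphere k → (Fin (k + 2) → ℝ), Continuous h ∧ Function.Injective h ∧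
      Set.range h = stdBoundary k := by
  let ext : NSphere k → Fin (k + 2) → ℝ := fun y => Fin.cons 0 (fun i => y.1 i)
  have hext : Continuous ext := by
    refine continuous_pi fun i => ?_
    refine Fin.cases ?_ (fun j => ?_) i
    · simpa [ext] using continuous_const
    · simp only [ext, Fin.cons_succ]
      exact (PiLp.continuous_apply 2 (fun _ => ℝ) j).comp continuous_subtype_val
  let m : NSphere k → ℝ := fun y => minCoord univ univ_nonempty (ext y)
  have hm : Continuous m := (continuous_minCoord _ _).comp hext
  have hnn : ∀ y i, 0 ≤ ext y i - m y := fun y i =>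
    sub_nonneg.2 (minCoord_le univ_nonempty _ (mem_univ i))
  have hpos : ∀ y, 0 < ∑ i, (ext y i - m y) := by
    intro y
    refine lt_of_le_of_ne (sum_nonneg fun i _ => hnn y i) fun h => ?_
    have hz := (sum_eq_zero_iff_of_nonneg fun i _ => hnn y i).1 h.symm
    have h0 : 0 - m y = 0 := hz 0 (mem_univ _)
    have hy0 : y.1 = 0 := by
      ext i
      have h1 : y.1 i - m y = 0 := hz i.succ (mem_univ _)
      simp only [PiLp.zero_apply]
      linarith
    have hy1 : ‖y.1‖ = 1 := by simpa using y.2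
    simp [hy0] at hy1
  refine ⟨fun y i => (ext y i - m y) / ∑ j, (ext y j - m y), ?_, ?_, ?_⟩
  · refine continuous_pi fun i => ?_
    refine (((continuous_apply i).comp hext).sub hm).div ?_ fun y => (hpos y).ne'
    exact continuous_finsetSum _ fun j _ => ((continuous_apply j).comp hext).sub hm
  · intro y z hyz
    have hyS := hpos y
    have hzS := hpos z
    set a := ∑ j, (ext y j - m y)
    set b := ∑ j, (ext z j - m z)
    have h0 : (0 - m y) / a = (0 - m z) / b := congrFun hyz 0
    have hi : ∀ i, y.1 i / a = z.1 i / b := by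
      intro i
      have h1 : (y.1 i - m y) / a = (z.1 i - m z) / b := congrFun hyz i.succ
      rw [sub_div] at h0 h1
      rw [sub_div (z.1 i)] at h1
      rw [sub_div 0 (m z)] at h0
      simp only [zero_div] at h0
      linarith
    have hsmul : y.1 = (a / b) • z.1 := by
      ext i
      have := hi i
      simp only [PiLp.smul_apply, smul_eq_mul]
      field_simp at this ⊢
      linarith
    have hy1 : ‖y.1‖ = 1 := by simpa using y.2
    have hz1 : ‖z.1‖ = 1 := by simpa using z.2
    have hab : a / b = 1 := by
      rw [hsmul, norm_smul, hz1, mul_one, Real.norm_of_nonneg (by positivity)] at hy1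
      exact hy1
    apply Subtype.ext
    rw [hsmul, hab, one_smul]
  · apply Set.Subset.antisymm
    · rintro _ ⟨y, rfl⟩
      refine ⟨fun i => div_nonneg (hnn y i) (hpos y).le, ?_, ?_⟩
      · rw [← sum_div, div_self (hpos y).ne']
      · obtain ⟨i, -, hi⟩ := exists_minCoord_eq (σ := univ) univ_nonempty (ext y)
        exact ⟨i, by simp [m, hi]⟩
    · rintro u ⟨h0, h1, i, hi⟩
      let w : EuclideanSpace ℝ (Fin (k + 1)) := WithLp.toLp 2 fun j => u j.succ - u 0
      have hw : w ≠ 0 := by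
        intro hw
        have hc : ∀ j : Fin (k + 1), u j.succ = u 0 := fun j => by
          have : w j = 0 := by rw [hw]; rfl
          exact sub_eq_zero.1 this
        have hc' : ∀ j, u j = u 0 := fun j => Fin.cases rfl hc j
        have : u 0 = 0 := by rw [← hc' i, hi]
        simp [hc', this] at h1
      have hn : 0 < ‖w‖ := norm_pos_iff.2 hw
      let y : NSphere k := ⟨‖w‖⁻¹ • w, by simp [norm_smul, hn.ne']⟩
      have hexty : ∀ j, ext y j = ‖w‖⁻¹ * (u j - u 0) := by
        intro j
        refine Fin.cases ?_ (fun l => ?_) j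
        · simp [ext]
        · simp [ext, y, w]
      have hmy : m y = ‖w‖⁻¹ * (0 - u 0) := by
        apply le_antisymm
        · rw [← hi, ← hexty]
          exact minCoord_le _ _ (mem_univ i)
        · refine le_inf' _ _ fun j _ => ?_
          rw [hexty]
          have := h0 j
          gcongr
      have hd : ∀ j, ext y j - m y = ‖w‖⁻¹ * u j := fun j => by rw [hexty, hmy]; ring
      refine ⟨y, funext fun j => ?_⟩
      simp only [hd, ← mul_sum, h1]
      field_simp

variable {V : Type} [DecidableEq V]

/-- The proper faces of the simplex `F`. -/
def properFaces (F : Finset V) : Set (Finset V) := {s | s.Nonempty ∧ s ⊂ F}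

lemma exists_sphere_param (k : ℕ) (F : Finset V) (hF : F.card = k + 2) :
    ∃ h : NSphere k → (V → ℝ), Continuous h ∧ Function.Injective h ∧
      Set.range h = geom (properFaces F) := by
  obtain ⟨h, hc, hinj, hr⟩ := exists_sphere_param_stdBoundary k
  let e : F ≃ Fin (k + 2) := F.equivFinOfCardEq hF
  let T : (Fin (k + 2) → ℝ) → V → ℝ := fun u v => if hv : v ∈ F then u (e ⟨v, hv⟩) else 0
  have hT : ∀ u i, T u (e.symm i) = u i := by
    intro u i
    simp [T]
  have hTc : Continuous T := by
    refine continuous_pi fun v => ?_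
    by_cases hv : v ∈ F
    · simpa [T, hv] using continuous_apply _
    · simpa [T, hv] using continuous_const
  have hsum : ∀ x : V → ℝ, ∑ v ∈ F, x v = ∑ i, x (e.symm i) := fun x => by
    rw [← sum_coe_sort F]
    exact (Equiv.sum_comp e.symm (fun v : F => x v)).symm
  refine ⟨T ∘ h, hTc.comp hc, ?_, ?_⟩
  · refine Function.Injective.comp (fun u u' huu => funext fun i => ?_) hinj
    rw [← hT u i, huu, hT]
  · rw [Set.range_comp, hr]
    ext x
    constructor
    · rintro ⟨u, ⟨h0, h1, i, hi⟩, rfl⟩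
      have hin : InSimplex F (T u) := by
        refine ⟨fun v => ?_, fun v hv => by simp [T, hv], ?_⟩
        · by_cases hv : v ∈ F
          · simpa [T, hv] using h0 _
          · simp [T, hv]
        · rw [hsum, ← h1]
          exact sum_congr rfl fun i _ => hT u i
      have hz : T u (e.symm i) = 0 := (hT u i).trans hi
      exact ⟨_, ⟨(hin.erase hz).nonempty, erase_ssubset (e.symm i).2⟩, hin.erase hz⟩
    · rintro ⟨s, ⟨-, hs⟩, hx⟩
      obtain ⟨v, hvF, hvs⟩ := exists_of_ssubset hs
      have hxF := hx.mono hs.subset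
      refine ⟨fun i => x (e.symm i), ⟨fun i => hx.1 _, ?_, ⟨e ⟨v, hvF⟩, ?_⟩⟩, ?_⟩
      · rw [← hsum, hxF.2.2]
      · simpa using hx.2.1 v hvs
      · funext u
        by_cases hu : u ∈ F
        · simp [T, hu]
        · simp [T, hu, hxF.2.1 u hu]

/-- The point of `V → ℝ` given by a vertex. -/
def vertexPoint (p : V) : V → ℝ := fun v => if v = p then 1 else 0

lemma eq_vertexPoint {p : V} {x : V → ℝ} (hx : InSimplex {p} x) : x = vertexPoint p := by
  funext v
  by_cases hv : v = p
  · subst hv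
    simpa [vertexPoint] using hx.2.2
  · simpa [vertexPoint, hv] using hx.2.1 v (by simpa using hv)

lemma vertexPoint_mem_geom {F : Finset V} {p : V} (hp : p ∈ F) (hF : 2 ≤ F.card) :
    vertexPoint p ∈ geom (properFaces F) := by
  refine ⟨{p}, ⟨singleton_nonempty p, ?_⟩, ?_, ?_, ?_⟩
  · refine ssubset_of_subset_of_ne (singleton_subset_iff.2 hp) ?_
    rintro rfl
    simp at hF
  · intro v; unfold vertexPoint; split_ifs <;> norm_num
  · intro v hv; simpa [vertexPoint] using hv
  · simp [vertexPoint]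

lemma InSimplex.inter {s t : Finset V} {x : V → ℝ} (hs : InSimplex s x) (ht : InSimplex t x) :
    InSimplex (s ∩ t) x := by
  refine ⟨hs.1, fun v hv => ?_, ?_⟩
  · by_cases h : v ∈ s
    · exact ht.2.1 v fun h' => hv (mem_inter.2 ⟨h, h'⟩)
    · exact hs.2.1 v h
  · rw [← hs.2.2]
    refine sum_subset inter_subset_left fun v hv hv' => ht.2.1 v fun h' => hv' ?_
    exact mem_inter.2 ⟨hv, h'⟩

lemma eq_vertexPoint_of_mem_geom {F G : Finset V} {p : V} (hFG : F ∩ G = {p}) {x : V → ℝ}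
    (hF : x ∈ geom (properFaces F)) (hG : x ∈ geom (properFaces G)) : x = vertexPoint p := by
  obtain ⟨s, hs, hxs⟩ := hF
  obtain ⟨t, ht, hxt⟩ := hG
  apply eq_vertexPoint
  rw [← hFG]
  exact (hxs.mono hs.2.subset).inter (hxt.mono ht.2.subset)

instance (k : ℕ) : CompactSpace (NSphere k) :=
  isCompact_iff_compactSpace.1 (isCompact_sphere (0 : EuclideanSpace ℝ (Fin (k + 1))) 1)

/-- Three simplex boundaries meeting in one common vertex form a wedge of spheres. -/
lemma geom_homeomorph_wedge {a b c : ℕ} {F G H : Finset V} {p : V} (hF : F.card = a + 2)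
    (hG : G.card = b + 2) (hH : H.card = c + 2) (hFG : F ∩ G = {p}) (hFH : F ∩ H = {p})
    (hGH : G ∩ H = {p}) :
    ∃ (x : NSphere a) (y : NSphere b) (z : NSphere c),
      Nonempty (geom (properFaces F ∪ properFaces G ∪ properFaces H) ≃ₜ
        Wedge3 (NSphere a) (NSphere b) (NSphere c) x y z) := by
  obtain ⟨f, hfc, hfi, hfr⟩ := exists_sphere_param a F hF
  obtain ⟨g, hgc, hgi, hgr⟩ := exists_sphere_param b G hG
  obtain ⟨h, hhc, hhi, hhr⟩ := exists_sphere_param c H hH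
  have hpFG : p ∈ F ∩ G := hFG ▸ mem_singleton_self p
  have hpGH : p ∈ G ∩ H := hGH ▸ mem_singleton_self p
  obtain ⟨x, hx⟩ : vertexPoint p ∈ Set.range f :=
    hfr ▸ vertexPoint_mem_geom (mem_inter.1 hpFG).1 (by omega)
  obtain ⟨y, hy⟩ : vertexPoint p ∈ Set.range g :=
    hgr ▸ vertexPoint_mem_geom (mem_inter.1 hpFG).2 (by omega)
  obtain ⟨z, hz⟩ : vertexPoint p ∈ Set.range h :=
    hhr ▸ vertexPoint_mem_geom (mem_inter.1 hpGH).2 (by omega)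
  refine ⟨x, y, z, ?_⟩
  have hfm : ∀ t, f t ∈ geom (properFaces F) := fun t => hfr ▸ Set.mem_range_self t
  have hgm : ∀ t, g t ∈ geom (properFaces G) := fun t => hgr ▸ Set.mem_range_self t
  have hhm : ∀ t, h t ∈ geom (properFaces H) := fun t => hhr ▸ Set.mem_range_self t
  have hunion : ∀ t : V → ℝ, t ∈ geom (properFaces F ∪ properFaces G ∪ properFaces H) ↔
      t ∈ geom (properFaces F) ∨ t ∈ geom (properFaces G) ∨ t ∈ geom (properFaces H) := by
    intro t
    constructor
    · rintro ⟨s, (hs | hs) | hs, ht⟩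
      exacts [Or.inl ⟨s, hs, ht⟩, Or.inr (Or.inl ⟨s, hs, ht⟩), Or.inr (Or.inr ⟨s, hs, ht⟩)]
    · rintro (⟨s, hs, ht⟩ | ⟨s, hs, ht⟩ | ⟨s, hs, ht⟩)
      exacts [⟨s, Or.inl (Or.inl hs), ht⟩, ⟨s, Or.inl (Or.inr hs), ht⟩, ⟨s, Or.inr hs, ht⟩]
  let φ : NSphere a ⊕ NSphere b ⊕ NSphere c → V → ℝ := Sum.elim f (Sum.elim g h)
  have hφc : Continuous φ := hfc.sumElim (hgc.sumElim hhc)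
  have hφm : ∀ t, φ t ∈ geom (properFaces F ∪ properFaces G ∪ properFaces H) := by
    rintro (t | t | t)
    · exact (hunion _).2 (Or.inl (hfm t))
    · exact (hunion _).2 (Or.inr (Or.inl (hgm t)))
    · exact (hunion _).2 (Or.inr (Or.inr (hhm t)))
  let ψ : Wedge3 (NSphere a) (NSphere b) (NSphere c) x y z →
      geom (properFaces F ∪ properFaces G ∪ properFaces H) :=
    Quot.lift (fun t => ⟨φ t, hφm t⟩) (by
      rintro u v (⟨rfl, rfl⟩ | ⟨rfl, rfl⟩)
      · exact Subtype.ext (hx.trans hy.symm)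
      · exact Subtype.ext (hx.trans hz.symm))
  have hψc : Continuous ψ := continuous_quot_lift _ (hφc.subtype_mk _)
  have hxy : (Quot.mk _ (Sum.inl x) : Wedge3 _ _ _ x y z) = Quot.mk _ (Sum.inr (Sum.inl y)) :=
    Quot.sound (Or.inl ⟨rfl, rfl⟩)
  have hxz : (Quot.mk _ (Sum.inl x) : Wedge3 _ _ _ x y z) = Quot.mk _ (Sum.inr (Sum.inr z)) :=
    Quot.sound (Or.inr ⟨rfl, rfl⟩)
  have hfx : ∀ t, f t = vertexPoint p → t = x := fun t ht => hfi (ht.trans hx.symm)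
  have hgy : ∀ t, g t = vertexPoint p → t = y := fun t ht => hgi (ht.trans hy.symm)
  have hhz : ∀ t, h t = vertexPoint p → t = z := fun t ht => hhi (ht.trans hz.symm)
  have hfg : ∀ s t, f s = g t → s = x ∧ t = y := fun s t hst => by
    have := eq_vertexPoint_of_mem_geom hFG (hfm s) (hst ▸ hgm t)
    exact ⟨hfx s this, hgy t (hst ▸ this)⟩
  have hfh : ∀ s t, f s = h t → s = x ∧ t = z := fun s t hst => by
    have := eq_vertexPoint_of_mem_geom hFH (hfm s) (hst ▸ hhm t)
    exact ⟨hfx s this, hhz t (hst ▸ this)⟩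
  have hgh : ∀ s t, g s = h t → s = y ∧ t = z := fun s t hst => by
    have := eq_vertexPoint_of_mem_geom hGH (hgm s) (hst ▸ hhm t)
    exact ⟨hgy s this, hhz t (hst ▸ this)⟩
  have hψi : Function.Injective ψ := by
    rintro ⟨u⟩ ⟨v⟩ huv
    have huv' : φ u = φ v := congrArg Subtype.val huv
    rcases u with u | u | u <;> rcases v with v | v | v
    · rw [hfi huv']
    · obtain ⟨rfl, rfl⟩ := hfg u v huv'
      exact hxy
    · obtain ⟨rfl, rfl⟩ := hfh u v huv'
      exact hxz
    · obtain ⟨rfl, rfl⟩ := hfg v u huv'.symm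
      exact hxy.symm
    · rw [hgi huv']
    · obtain ⟨rfl, rfl⟩ := hgh u v huv'
      exact hxy.symm.trans hxz
    · obtain ⟨rfl, rfl⟩ := hfh v u huv'.symm
      exact hxz.symm
    · obtain ⟨rfl, rfl⟩ := hgh v u huv'.symm
      exact hxz.symm.trans hxy
    · rw [hhi huv']
  have hψs : Function.Surjective ψ := by
    rintro ⟨t, ht⟩
    rcases (hunion t).1 ht with h' | h' | h'
    · obtain ⟨u, rfl⟩ := hfr.symm ▸ h'
      exact ⟨Quot.mk _ (Sum.inl u), rfl⟩
    · obtain ⟨u, rfl⟩ := hgr.symm ▸ h'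
      exact ⟨Quot.mk _ (Sum.inr (Sum.inl u)), rfl⟩
    · obtain ⟨u, rfl⟩ := hhr.symm ▸ h'
      exact ⟨Quot.mk _ (Sum.inr (Sum.inr u)), rfl⟩
  have : CompactSpace (Wedge3 (NSphere a) (NSphere b) (NSphere c) x y z) :=
    inferInstanceAs (CompactSpace (Quot _))
  exact ⟨(Continuous.homeoOfEquivCompactToT2 (f := Equiv.ofBijective ψ ⟨hψi, hψs⟩) hψc).symm⟩

end Sphere

/-! ### Separating top cells into disjoint spheres -/

section Cells

variable {V : Type}

lemma properFaces_downClosed (F : Finset V) : DownClosed (properFaces F) :=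
  fun _ hs _ hts ht => ⟨ht, lt_of_le_of_lt hts hs.2⟩

lemma DownClosed.union {K L : Set (Finset V)} (hK : DownClosed K) (hL : DownClosed L) :
    DownClosed (K ∪ L) := by
  rintro s (hs | hs) t hts ht
  · exact Or.inl (hK s hs t hts ht)
  · exact Or.inr (hL s hs t hts ht)

variable [DecidableEq V]

lemma DownClosed.attachCone {K C : Set (Finset V)} {p : V} (hK : DownClosed K)
    (hC : DownClosed C) (hCK : C ⊆ K) : DownClosed (attachCone K C p) := by
  rintro s hs t hts ht
  by_cases hpt : p ∈ t
  · refine Or.inr ⟨hpt, ?_⟩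
    by_cases h : (t.erase p).Nonempty
    · right
      rcases hs with hs | ⟨-, rfl | hs⟩
      · exact absurd (hts hpt) hs.1
      · grind
      · exact hC _ hs _ (erase_subset_erase p hts) h
    · left
      rw [not_nonempty_iff_eq_empty, erase_eq_empty_iff] at h
      exact h.resolve_left ht.ne_empty
  · refine Or.inl ⟨hpt, ?_⟩
    rcases hs with hs | ⟨-, rfl | hs⟩
    · exact hK _ hs.2 _ hts ht
    · grind
    · exact hK _ (hCK hs) _ (subset_erase.2 ⟨hts, hpt⟩) ht

/-- The complex `K` without the three cells `F`, `G`, `H`. -/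
def withoutCells (K : Set (Finset V)) (F G H : Finset V) : Set (Finset V) :=
  {s ∈ K | s ≠ F ∧ s ≠ G ∧ s ≠ H}

/-- After coning off the complement of three cells, only the three resulting spheres remain. -/
lemma collapses_attachCone_withoutCells {K : Set (Finset V)} {U F G H : Finset V} {p : V}
    (hK : DownClosed K) (hU : ∀ s ∈ K, s ⊆ U) (hne : ∀ s ∈ K, s.Nonempty) (hp : p ∉ U)
    (hF : F ∈ K) (hG : G ∈ K) (hH : H ∈ K)
    (hFG : ¬ F ⊆ G) (hFH : ¬ F ⊆ H) (hGF : ¬ G ⊆ F) (hGH : ¬ G ⊆ H) (hHF : ¬ H ⊆ F)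
    (hHG : ¬ H ⊆ G) :
    Collapses (attachCone K (withoutCells K F G H) p)
      (properFaces (insert p F) ∪ properFaces (insert p G) ∪ properFaces (insert p H)) := by
  classical
  let T : Finset (Finset V) :=
    U.powerset.filter fun s => s ∈ K ∧ ¬ s ⊆ F ∧ ¬ s ⊆ G ∧ ¬ s ⊆ H
  have hT : ∀ s, s ∈ T ↔ s ∈ K ∧ ¬ s ⊆ F ∧ ¬ s ⊆ G ∧ ¬ s ⊆ H := by
    intro s
    simp only [T, mem_filter, mem_powerset, and_iff_right_iff_imp]
    exact fun h => hU s h.1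
  have hpK : ∀ s ∈ K, p ∉ s := fun s hs h => hp (hU s hs h)
  have key := Collapses.family (attachCone K (withoutCells K F G H) p) T id (fun _ => p)
    (fun s hs => hne s ((hT s).1 hs).1) (fun s hs => hpK s ((hT s).1 hs).1) ?_ ?_
  · convert key using 1
    ext s
    simp only [id, Set.mem_ofPred_eq, Set.mem_union]
    constructor
    · have hcell : ∀ A : Finset V, A ∈ K → (A = F ∨ A = G ∨ A = H) → s ∈ properFaces (insert p A) →
          s ∈ attachCone K (withoutCells K F G H) p ∧ ∀ σ ∈ T, ¬ σ ⊆ s := by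
        rintro A hA hAF ⟨hs, hsA⟩
        have herase : s.erase p ⊆ A := by
          have := hsA.subset
          grind
        refine ⟨?_, fun σ hσ hσs => ?_⟩
        · by_cases hps : p ∈ s
          · refine Or.inr ⟨hps, ?_⟩
            by_cases h0 : (s.erase p).Nonempty
            · right
              have hneA : s.erase p ≠ A := by
                rintro rfl
                rw [insert_erase hps] at hsA
                exact hsA.ne rfl
              refine ⟨hK A hA _ herase h0, ?_, ?_, ?_⟩ <;>
              · rintro h
                rw [h] at herase hneA
                rcases hAF with rfl | rfl | rfl <;> contradiction
            · left
              rw [not_nonempty_iff_eq_empty, erase_eq_empty_iff] at h0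
              exact h0.resolve_left hs.ne_empty
          · refine Or.inl ⟨hps, hK A hA s ?_ hs⟩
            rwa [erase_eq_of_notMem hps] at herase
        · have hσ' := (hT σ).1 hσ
          have hσA : σ ⊆ A := by
            have := hpK σ hσ'.1
            intro v hv
            exact herase (mem_erase.2 ⟨fun h => this (h ▸ hv), hσs hv⟩)
          rcases hAF with rfl | rfl | rfl
          · exact hσ'.2.1 hσA
          · exact hσ'.2.2.1 hσA
          · exact hσ'.2.2.2 hσA
      rintro ((h | h) | h)
      · exact hcell F hF (by simp) h
      · exact hcell G hG (by simp) h
      · exact hcell H hH (by simp) h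
    · rintro ⟨hs, hbad⟩
      have hpr : ∀ A : Finset V, p ∉ A → s.Nonempty → s.erase p ⊆ A → (p ∈ s → s.erase p ≠ A) →
          s ∈ properFaces (insert p A) := by
        intro A hpA hs hsub hne
        refine ⟨hs, ?_⟩
        rw [Finset.ssubset_iff_subset_ne]
        refine ⟨by grind, ?_⟩
        rintro rfl
        exact hne (mem_insert_self p A) (erase_insert hpA)
      rcases hs with ⟨hps, hs⟩ | ⟨hps, rfl | hs⟩
      · have : s ⊆ F ∨ s ⊆ G ∨ s ⊆ H := by
          by_contra! hcon
          exact hbad s ((hT s).2 ⟨hs, hcon⟩) subset_rfl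
        have hes : s.erase p = s := erase_eq_of_notMem hps
        rcases this with h | h | h
        · exact Or.inl (Or.inl (hpr F (hpK F hF) (hne s hs) (by rw [hes]; exact h)
            fun h => absurd h hps))
        · exact Or.inl (Or.inr (hpr G (hpK G hG) (hne s hs) (by rw [hes]; exact h)
            fun h => absurd h hps))
        · exact Or.inr (hpr H (hpK H hH) (hne s hs) (by rw [hes]; exact h) fun h => absurd h hps)
      · refine Or.inl (Or.inl (hpr F (hpK F hF) (singleton_nonempty p) (by simp) fun _ h => ?_))
        have := hne F hF
        rw [← h] at this
        simp at this
      · have : s.erase p ⊆ F ∨ s.erase p ⊆ G ∨ s.erase p ⊆ H := by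
          by_contra! hcon
          exact hbad _ ((hT _).2 ⟨hs.1, hcon⟩) (erase_subset p s)
        rcases this with h | h | h
        · exact Or.inl (Or.inl (hpr F (hpK F hF) ⟨p, hps⟩ h fun _ => hs.2.1))
        · exact Or.inl (Or.inr (hpr G (hpK G hG) ⟨p, hps⟩ h fun _ => hs.2.2.1))
        · exact Or.inr (hpr H (hpK H hH) ⟨p, hps⟩ h fun _ => hs.2.2.2)
  · intro σ hσ s hs hσs
    have hσ' := (hT σ).1 hσ
    by_cases hps : p ∈ s
    · rwa [insert_eq_of_mem hps]
    · rcases hs with hs | hs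
      · refine Or.inr ⟨mem_insert_self p s, Or.inr ?_⟩
        rw [erase_insert hps]
        refine ⟨hs.2, ?_, ?_, ?_⟩
        · rintro rfl; exact hσ'.2.1 hσs
        · rintro rfl; exact hσ'.2.2.1 hσs
        · rintro rfl; exact hσ'.2.2.2 hσs
      · exact absurd hs.1 hps
  · intro σ _ ρ hρ s _ _ hsub v hv
    have hv' := mem_insert.1 (hsub hv)
    refine hv'.resolve_left ?_
    rintro rfl
    exact hpK ρ ((hT ρ).1 hρ).1 hv

/-- The vertex `z` of a tetrahedron boundary attached along the edge `pz` can be replaced by a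
new vertex `q`, so that the tetrahedron boundary is attached only at `p`. -/
lemma homotopyEquiv_replace_vertex {R : Set (Finset V)} {p e o z q : V} (hR : DownClosed R)
    (hpR : {p, z} ∈ R) (hRe : ∀ s ∈ R, e ∉ s) (hRo : ∀ s ∈ R, o ∉ s) (hRq : ∀ s ∈ R, q ∉ s)
    (hpe : p ≠ e) (hpo : p ≠ o) (hpz : p ≠ z) (hpq : p ≠ q) (hez : e ≠ z)
    (heq : e ≠ q) (hoz : o ≠ z) (hoq : o ≠ q) (hzq : z ≠ q) :
    Nonempty (ContinuousMap.HomotopyEquiv (geom (properFaces {p, e, o, z} ∪ R))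
      (geom (properFaces {p, e, o, q} ∪ R))) := by
  let M : Set (Finset V) := {s | s.Nonempty ∧ s ⊆ {p, e, o, z} ∧ ¬ {p, e, o} ⊆ s}
  have hM : DownClosed M := fun s hs t hts ht =>
    ⟨ht, hts.trans hs.2.1, fun h => hs.2.2 (h.trans hts)⟩
  have hMK : M ⊆ properFaces {p, e, o, z} ∪ R := by
    rintro s ⟨hs, hsub, hnot⟩
    refine Or.inl ⟨hs, Finset.ssubset_iff_subset_ne.2 ⟨hsub, ?_⟩⟩
    rintro rfl
    exact hnot (by grind)
  have hY : DownClosed (attachCone (properFaces {p, e, o, z} ∪ R) M q) :=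
    ((properFaces_downClosed _).union hR).attachCone hM hMK
  have hqK : ∀ s ∈ properFaces {p, e, o, z} ∪ R, q ∉ s := by
    rintro s (hs | hs)
    · intro hq
      have := hs.2.subset hq
      grind
    · exact hRq s hs
  have c1 : Collapses (attachCone (properFaces {p, e, o, z} ∪ R) M q)
      (properFaces {p, e, o, z} ∪ R) := by
    refine Relation.ReflTransGen.single ⟨{q}, z, singleton_nonempty _, by simpa using hzq, ?_, ?_⟩
    · rintro s hs hq
      have hqs : q ∈ s := by simpa using hq
      refine Or.inr ⟨mem_insert_of_mem hqs, Or.inr ?_⟩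
      rw [erase_insert_of_ne hzq]
      rcases hs with hs | ⟨-, rfl | hs⟩
      · exact absurd hqs hs.1
      · refine ⟨insert_nonempty _ _, by grind, ?_⟩
        intro h
        have : p ∈ insert z (({q} : Finset V).erase q) := h (by simp)
        grind
      · refine ⟨insert_nonempty _ _, by have := hs.2.1; grind, ?_⟩
        intro h
        apply hs.2.2
        intro v hv
        have := h hv
        grind
    · ext s
      constructor
      · intro hs
        exact ⟨Or.inl ⟨hqK s hs, hs⟩, by simpa using hqK s hs⟩
      · rintro ⟨hs | hs, hq⟩
        · exact hs.2
        · exact absurd (by simpa using hs.1) hq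
  have c2 := Collapses.family (attachCone (properFaces {p, e, o, z} ∪ R) M q)
    (Finset.univ : Finset Bool) (fun b => {z, if b then e else o}) (fun _ => q)
    (fun b _ => insert_nonempty _ _) (by rintro (_ | _) - <;> grind) ?_ ?_
  · have c3 := Collapses.single (K := {s ∈ attachCone (properFaces {p, e, o, z} ∪ R) M q |
      ∀ b ∈ (Finset.univ : Finset Bool), ¬ ({z, if b then e else o} : Finset V) ⊆ s})
      (σ := {z, q}) (w := p) (insert_nonempty _ _) (by grind) ?_
    · obtain ⟨f⟩ := c1.homotopyEquiv hY
      obtain ⟨g⟩ := Collapses.homotopyEquiv (c2.trans c3) hY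
      have : properFaces {p, e, o, q} ∪ R =
          {s ∈ {s ∈ attachCone (properFaces {p, e, o, z} ∪ R) M q |
            ∀ b ∈ (Finset.univ : Finset Bool), ¬ ({z, if b then e else o} : Finset V) ⊆ s} |
            ¬ {z, q} ⊆ s} := by
        clear f g c1 c2 c3 hY hqK hMK hM
        ext s
        simp only [Set.mem_ofPred_eq, Set.mem_union, mem_univ, true_imp_iff, Bool.forall_bool,
          Bool.false_eq_true, if_true, if_false, insert_subset_iff, singleton_subset_iff]
        constructor
        · rintro (⟨hne, hs⟩ | hs)
          · have hsub := hs.subset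
            have hz : z ∉ s := fun h => by
              have := hsub h
              grind
            refine ⟨⟨?_, by tauto⟩, by tauto⟩
            by_cases hq : q ∈ s
            · refine Or.inr ⟨hq, ?_⟩
              by_cases h0 : (s.erase q).Nonempty
              · refine Or.inr ⟨h0, by grind, fun h => hs.ne ?_⟩
                apply hsub.antisymm
                intro v hv
                have := @h v
                grind
              · left
                rw [not_nonempty_iff_eq_empty, erase_eq_empty_iff] at h0
                exact h0.resolve_left hne.ne_empty
            · refine Or.inl ⟨hq, Or.inl ⟨hne, Finset.ssubset_iff_subset_ne.2 ⟨by grind, ?_⟩⟩⟩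
              rintro rfl
              simp at hz
          · have := hRe s hs
            have := hRo s hs
            have := hRq s hs
            exact ⟨⟨Or.inl ⟨this, Or.inr hs⟩, by tauto⟩, by tauto⟩
        · rintro ⟨⟨⟨hq, ⟨hne, hs⟩ | hs⟩ | ⟨hq, rfl | hs⟩, ho, he⟩, hzq'⟩
          · by_cases hz : z ∈ s
            · right
              refine hR _ hpR s ?_ hne
              have := hs.subset
              intro v hv
              have := this hv
              grind
            · left
              refine ⟨hne, Finset.ssubset_iff_subset_ne.2 ⟨?_, ?_⟩⟩
              · have := hs.subset
                intro v hv
                have := this hv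
                grind
              · rintro rfl
                simp at hq
          · exact Or.inr hs
          · left
            refine ⟨singleton_nonempty _, Finset.ssubset_iff_subset_ne.2 ⟨by simp, ?_⟩⟩
            intro h
            have : p ∈ ({q} : Finset V) := by rw [h]; simp
            simp at this
            exact hpq this
          · left
            refine ⟨⟨q, hq⟩, Finset.ssubset_iff_subset_ne.2 ⟨?_, ?_⟩⟩
            · have := hs.2.1
              intro v hv
              have := @this v
              grind
            · rintro rfl
              refine hs.2.2 fun v hv => ?_
              grind
      rw [this]
      exact ⟨f.symm.trans g⟩
    · rintro s ⟨hs, hb⟩ hzqs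
      have hz : z ∈ s := hzqs (by simp)
      have hq : q ∈ s := hzqs (by simp)
      have hes : e ∉ s := fun h => hb true (mem_univ _) (by grind)
      have hos : o ∉ s := fun h => hb false (mem_univ _) (by grind)
      refine ⟨Or.inr ⟨mem_insert_of_mem hq, Or.inr ?_⟩, ?_⟩
      · rw [erase_insert_of_ne hpq]
        refine ⟨insert_nonempty _ _, ?_, ?_⟩
        · rcases hs with hs | ⟨-, rfl | hs⟩
          · exact absurd hq hs.1
          · grind
          · have := hs.2.1
            grind
        · intro h
          have : e ∈ insert p (s.erase q) := h (by simp)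
          grind
      · rintro (_ | _) - h
        · have : o ∈ insert p s := h (by simp)
          grind
        · have : e ∈ insert p s := h (by simp)
          grind
  · rintro b - s hs hb
    by_cases hq : q ∈ s
    · rwa [insert_eq_of_mem hq]
    · rcases hs with ⟨-, hs | hs⟩ | hs
      · refine Or.inr ⟨mem_insert_self q s, Or.inr ?_⟩
        rw [erase_insert hq]
        refine ⟨hs.1, hs.2.subset, fun h => hs.2.ne (hs.2.subset.antisymm ?_)⟩
        have hz : z ∈ s := hb (by simp)
        intro v hv
        have := @h v
        grind
      · exfalso
        have hmem : (if b then e else o) ∈ s := hb (by simp)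
        have := hRe s hs
        have := hRo s hs
        cases b <;> simp_all
      · exact absurd hs.1 hq
  · rintro b - b' - s - - hsub v hv
    have := hsub hv
    cases b' <;> grind

end Cells

/-! ### The combinatorial model of the pure Morse complex of a cycle -/

section CycleModel

/-- Vertices of the combinatorial model: `E i` and `O i` stand for the two kinds of arcs of the
Hasse diagram of a cycle, `P` and `Q` are two auxiliary cone points. -/
inductive Label
  | E (i : ℕ)
  | O (i : ℕ)
  | P
  | Q
  deriving DecidableEq

open Label

/-- The number of steps from `a` to `y` on the cycle of length `n`. -/
def off (n a y : ℕ) : ℕ := if a ≤ y then y - a else y + n - a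

/-- The position reached from `a` after `k` steps on the cycle of length `n`. -/
def adv (n a k : ℕ) : ℕ := if a + k < n then a + k else a + k - n

lemma off_self (n a : ℕ) : off n a a = 0 := by
  simp [off]

lemma off_lt {n a y : ℕ} (ha : a < n) (hy : y < n) : off n a y < n := by
  unfold off
  split_ifs <;> omega

lemma adv_lt {n a k : ℕ} (ha : a < n) (hk : k ≤ n) : adv n a k < n := by
  unfold adv
  split_ifs <;> omega

lemma off_adv {n a k : ℕ} (ha : a < n) (hk : k < n) : off n a (adv n a k) = k := by
  unfold off adv
  split_ifs <;> omega

lemma adv_off {n a y : ℕ} (ha : a < n) (hy : y < n) : adv n a (off n a y) = y := by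
  unfold off adv
  split_ifs <;> omega

lemma adv_one_ne {n : ℕ} (hn : 2 ≤ n) (a : ℕ) : adv n a 1 ≠ a := by
  unfold adv
  split_ifs <;> omega

lemma off_inj {n a x y : ℕ} (ha : a < n) (hx : x < n) (hy : y < n) (h : off n a x = off n a y) :
    x = y := by
  rw [← adv_off ha hx, h, adv_off ha hy]

/-- All elements of `s` are labels `E i` or `O i` with `i < n`. -/
def Valid (n : ℕ) (s : Finset Label) : Prop := ∀ v ∈ s, ∃ i < n, v = E i ∨ v = O i

lemma Valid.lt_E {n : ℕ} {s : Finset Label} (h : Valid n s) {i : ℕ} (hi : E i ∈ s) : i < n := by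
  obtain ⟨j, hj, h | h⟩ := h _ hi <;> grind

lemma Valid.lt_O {n : ℕ} {s : Finset Label} (h : Valid n s) {i : ℕ} (hi : O i ∈ s) : i < n := by
  obtain ⟨j, hj, h | h⟩ := h _ hi <;> grind

lemma Valid.insert_E {n : ℕ} {s : Finset Label} (h : Valid n s) {i : ℕ} (hi : i < n) :
    Valid n (insert (E i) s) :=
  forall_mem_insert _ _ _ |>.2 ⟨⟨i, hi, Or.inl rfl⟩, h⟩

lemma Valid.insert_O {n : ℕ} {s : Finset Label} (h : Valid n s) {i : ℕ} (hi : i < n) :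
    Valid n (insert (O i) s) :=
  forall_mem_insert _ _ _ |>.2 ⟨⟨i, hi, Or.inr rfl⟩, h⟩

/-- Counting from `a`, all `E`-labels of `s` weakly precede all `O`-labels of `s`, and the
latter lie at distance at most `D`. -/
def Anchored (n D : ℕ) (s : Finset Label) (a : ℕ) : Prop :=
  ∀ x y, E x ∈ s → O y ∈ s → off n a x ≤ off n a y ∧ off n a y ≤ D

/-- The complex on the labels `E i`, `O i` with `i < n` whose faces either consist of labels of one
kind and miss at least one label of that kind, or contain labels of both kinds and are anchored
at one of their `E`-labels. -/
def cyc (n D : ℕ) : Set (Finset Label) :=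
  {s | Valid n s ∧ s.Nonempty ∧
    (((∀ i, O i ∉ s) ∧ ∃ i < n, E i ∉ s) ∨ ((∀ i, E i ∉ s) ∧ ∃ i < n, O i ∉ s) ∨
      (∃ b, O b ∈ s) ∧ ∃ a, E a ∈ s ∧ Anchored n D s a)}

lemma mem_cyc_of_anchored {n D : ℕ} {s : Finset Label} (hs : Valid n s) {a b : ℕ} (ha : E a ∈ s)
    (hb : O b ∈ s) (h : Anchored n D s a) : s ∈ cyc n D :=
  ⟨hs, ⟨_, ha⟩, Or.inr (Or.inr ⟨⟨b, hb⟩, a, ha, h⟩)⟩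

lemma exists_anchored_of_mem_cyc {n D : ℕ} {s : Finset Label} (hs : s ∈ cyc n D) {a b : ℕ}
    (ha : E a ∈ s) (hb : O b ∈ s) : ∃ c, E c ∈ s ∧ Anchored n D s c := by
  obtain ⟨-, -, h | h | h⟩ := hs
  · exact absurd hb (h.1 b)
  · exact absurd ha (h.1 a)
  · exact h.2

lemma Anchored.mono {n D D' : ℕ} {s : Finset Label} {a : ℕ} (h : Anchored n D s a)
    (hD : D ≤ D') : Anchored n D' s a :=
  fun x y hx hy => ⟨(h x y hx hy).1, (h x y hx hy).2.trans hD⟩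

lemma cyc_mono {n D D' : ℕ} (hD : D ≤ D') : cyc n D ⊆ cyc n D' := by
  rintro s ⟨hv, hne, h | h | ⟨hb, a, ha, h⟩⟩
  · exact ⟨hv, hne, Or.inl h⟩
  · exact ⟨hv, hne, Or.inr (Or.inl h)⟩
  · exact ⟨hv, hne, Or.inr (Or.inr ⟨hb, a, ha, h.mono hD⟩)⟩

lemma eq_of_off_le {n D a c : ℕ} (hc : c < n) (hD : D < n)
    (h1 : off n c a ≤ off n c (adv n a D)) (h2 : off n c (adv n a D) ≤ D) : c = a := by
  unfold off adv at *
  split_ifs at * <;> omega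

/-- A face of `cyc n D` containing `E a` and the `O`-label at distance `D` is anchored at `a`. -/
lemma anchored_of_mem {n D : ℕ} {s : Finset Label} (hs : s ∈ cyc n D) (hD : D < n) {a : ℕ}
    (ha : E a ∈ s) (hb : O (adv n a D) ∈ s) : Anchored n D s a := by
  obtain ⟨c, hc, h⟩ := exists_anchored_of_mem_cyc hs ha hb
  have h' := h _ _ ha hb
  rwa [← eq_of_off_le (hs.1.lt_E hc) hD h'.1 h'.2]

lemma cyc_downClosed {n D : ℕ} (hD : D + 2 ≤ n) : DownClosed (cyc n D) := by
  rintro s ⟨hv, -, h⟩ t hts ht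
  have hvt : Valid n t := fun v hv' => hv v (hts hv')
  refine ⟨hvt, ht, ?_⟩
  rcases h with ⟨h, i, hi, his⟩ | ⟨h, i, hi, his⟩ | ⟨⟨b, hb⟩, a, ha, h⟩
  · exact Or.inl ⟨fun j hj => h j (hts hj), i, hi, fun h => his (hts h)⟩
  · exact Or.inr (Or.inl ⟨fun j hj => h j (hts hj), i, hi, fun h => his (hts h)⟩)
  have han := hv.lt_E ha
  have hpred : ∃ k < n, D < off n a k := by
    refine ⟨adv n a (n - 1), adv_lt han (by omega), ?_⟩
    rw [off_adv han (by omega)]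
    omega
  obtain ⟨k, hk, hDk⟩ := hpred
  by_cases hO : ∃ y, O y ∈ t
  · by_cases hE : ∃ x, E x ∈ t
    · obtain ⟨y, hy⟩ := hO
      refine Or.inr (Or.inr ⟨⟨y, hy⟩, ?_⟩)
      have hne : ((range n).filter fun x => E x ∈ t).Nonempty := by
        obtain ⟨x, hx⟩ := hE
        exact ⟨x, mem_filter.2 ⟨mem_range.2 (hvt.lt_E hx), hx⟩⟩
      obtain ⟨c, hc, hmin⟩ := exists_min_image _ (off n a) hne
      rw [mem_filter, mem_range] at hc
      refine ⟨c, hc.2, fun x y hx hy => ?_⟩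
      have hxn := hvt.lt_E hx
      have hyn := hvt.lt_O hy
      have h1 := h x y (hts hx) (hts hy)
      have h2 := h c y (hts hc.2) (hts hy)
      have h3 := hmin x (mem_filter.2 ⟨mem_range.2 hxn, hx⟩)
      have hcn := hc.1
      clear hmin hne hDk
      unfold off at *
      split_ifs at * <;> omega
    · push Not at hE
      refine Or.inr (Or.inl ⟨hE, k, hk, fun hkt => ?_⟩)
      have := (h a k ha (hts hkt)).2
      omega
  · push Not at hO
    refine Or.inl ⟨hO, k, hk, fun hkt => ?_⟩
    have := h k b (hts hkt) hb
    omega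

/-- The complexes `cyc n D` collapse onto each other as the distance bound `D` decreases. -/
lemma cyc_collapses_pred {n D : ℕ} (hD : D + 3 ≤ n) (h2 : 2 ≤ D) :
    Collapses (cyc n D) (cyc n (D - 1)) := by
  have hEins : ∀ {s : Finset Label} {i j : ℕ}, E i ∈ insert (O j) s ↔ E i ∈ s := by simp
  have hOins : ∀ {s : Finset Label} {i j : ℕ}, O i ∈ insert (E j) s ↔ O i ∈ s := by simp
  have c1 := Collapses.family (cyc n D) (range n) (fun a => {E a, O a, O (adv n a D)})
    (fun a => O (adv n a 1)) (fun a _ => insert_nonempty _ _) ?_ ?_ ?_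
  have c2 := Collapses.family {s ∈ cyc n D | ∀ a ∈ range n, ¬ {E a, O a, O (adv n a D)} ⊆ s}
    (range n) (fun a => {E a, O (adv n a D)}) (fun a => E (adv n a 1))
    (fun a _ => insert_nonempty _ _) ?_ ?_ ?_
  · convert Relation.ReflTransGen.trans c1 c2 using 1
    ext s
    simp only [Set.mem_ofPred_eq, mem_range, insert_subset_iff, singleton_subset_iff]
    constructor
    · intro hs
      have key : ∀ a < n, ¬ (E a ∈ s ∧ O (adv n a D) ∈ s) := by
        rintro a ha ⟨h1, h2⟩
        obtain ⟨c, hc, h⟩ := exists_anchored_of_mem_cyc hs h1 h2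
        have h' := h _ _ h1 h2
        have hca := eq_of_off_le (hs.1.lt_E hc) (by omega) h'.1 (by omega)
        rw [hca, off_adv ha (by omega)] at h'
        omega
      exact ⟨⟨cyc_mono (by omega) hs, fun a ha h => key a ha ⟨h.1, h.2.2⟩⟩, key⟩
    · rintro ⟨⟨⟨hv, hne, h | h | ⟨hb, a, ha, h⟩⟩, -⟩, hs⟩
      · exact ⟨hv, hne, Or.inl h⟩
      · exact ⟨hv, hne, Or.inr (Or.inl h)⟩
      · refine ⟨hv, hne, Or.inr (Or.inr ⟨hb, a, ha, fun x y hx hy => ?_⟩)⟩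
        have h' := h x y hx hy
        refine ⟨h'.1, ?_⟩
        have : off n a y ≠ D := by
          rintro rfl
          refine hs a (hv.lt_E ha) ⟨ha, ?_⟩
          rwa [adv_off (hv.lt_E ha) (hv.lt_O hy)]
        omega
  · intro a ha
    simp only [mem_insert, mem_singleton, reduceCtorEq, E.injEq, or_false]
    exact adv_one_ne (by omega) a
  · rintro a ha s ⟨hs, hs1⟩ hsub
    simp only [mem_range, insert_subset_iff, singleton_subset_iff] at ha hs1 hsub
    obtain ⟨hE, hO⟩ := hsub
    have hanch := anchored_of_mem hs (by omega) hE hO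
    have hOa : O a ∉ s := fun h => hs1 a ha ⟨hE, h, hO⟩
    have h1 : adv n a 1 < n := adv_lt ha (by omega)
    refine ⟨mem_cyc_of_anchored (hs.1.insert_E h1) (mem_insert_of_mem hE) (mem_insert_of_mem hO)
      fun x y hx hy => ?_, ?_⟩
    · rw [hOins] at hy
      rcases mem_insert.1 hx with hx | hx
      · obtain rfl : x = adv n a 1 := by simpa using hx
        rw [off_adv ha (by omega)]
        refine ⟨?_, (hanch a y hE hy).2⟩
        rw [Nat.one_le_iff_ne_zero, ← off_self n a]
        intro h
        exact hOa (off_inj ha (hs.1.lt_O hy) ha h ▸ hy)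
      · exact hanch x y hx hy
    · simp only [mem_range, insert_subset_iff, singleton_subset_iff, hOins]
      rintro j hj ⟨hEj, hOj, hOD⟩
      rcases mem_insert.1 hEj with hEj | hEj
      · obtain rfl : j = adv n a 1 := by simpa using hEj
        have := (hanch a _ hE hOD).2
        unfold off adv at this
        split_ifs at this <;> omega
      · exact hs1 j hj ⟨hEj, hOj, hOD⟩
  · rintro a ha j hj s ⟨hs, hs1⟩ hsub
    simp only [mem_range, insert_subset_iff, singleton_subset_iff, hOins] at ha hj hs1 hsub ⊢
    rintro ⟨hEj, hOD⟩
    have hanch := anchored_of_mem hs (by omega) hsub.1 hsub.2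
    rcases mem_insert.1 hEj with hEj | hEj
    · obtain rfl : j = adv n a 1 := by simpa using hEj
      have := (hanch a _ hsub.1 hOD).2
      unfold off adv at this
      split_ifs at this <;> omega
    · exact ⟨hEj, hOD⟩
  · intro a ha
    rw [mem_range] at ha
    simp only [mem_insert, mem_singleton, reduceCtorEq, O.injEq, false_or, not_or]
    unfold adv
    split_ifs <;> omega
  · intro a ha s hs hsub
    simp only [mem_range, insert_subset_iff, singleton_subset_iff] at ha hsub
    have hanch := anchored_of_mem hs (by omega) hsub.1 hsub.2.2
    have h1 : adv n a 1 < n := adv_lt ha (by omega)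
    refine mem_cyc_of_anchored (hs.1.insert_O h1) (mem_insert_of_mem hsub.1)
      (mem_insert_of_mem hsub.2.1) fun x y hx hy => ?_
    rw [hEins] at hx
    rcases mem_insert.1 hy with hy | hy
    · obtain rfl : y = adv n a 1 := by simpa using hy
      have := (hanch x a hx hsub.2.1).1
      rw [off_self] at this
      rw [off_adv ha (by omega)]
      omega
    · exact hanch x y hx hy
  · intro a ha j hj s hs hsub
    simp only [mem_range, insert_subset_iff, singleton_subset_iff, hEins] at ha hj hsub ⊢
    rintro ⟨hEj, -⟩
    have hanch := anchored_of_mem hs (by omega) hsub.1 hsub.2.2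
    have := (hanch j a hEj hsub.2.1).1
    obtain rfl : j = a := off_inj ha hj ha (by rw [off_self] at *; omega)
    exact hsub

lemma cyc_collapses_one {n : ℕ} (hn : 4 ≤ n) : Collapses (cyc n (n - 3)) (cyc n 1) := by
  have : ∀ k, k + 4 ≤ n → Collapses (cyc n (k + 1)) (cyc n 1) := by
    intro k
    induction k with
    | zero => exact fun _ => Relation.ReflTransGen.refl
    | succ k ih =>
      exact fun hk => (cyc_collapses_pred (by omega) (by omega)).trans (ih (by omega))
  convert this (n - 4) (by omega) using 2
  omega

end CycleModel

section CellComplement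

open Label

/-- The complement of three top cells in `cyc n 1`. -/
def cellComplement (n : ℕ) : Set (Finset Label) :=
  withoutCells (cyc n 1) {E 0, O 0, O 1} ((Ico 1 n).image E) ((Ico 1 n).image O)

/-- The edges of `cyc n 1` joining labels of different kinds, in cyclic order. -/
def mixedEdge (n t : ℕ) : Finset Label := {E (t / 2), O (adv n (t / 2) (t % 2))}

/-- The faces of `cellComplement n` containing none of the mixed edges `1, …, t - 1`. -/
def stage (n t : ℕ) : Set (Finset Label) :=
  {s ∈ cellComplement n | ∀ j, 1 ≤ j → j < t → ¬ mixedEdge n j ⊆ s}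

lemma mixedEdge_subset {n t : ℕ} {s : Finset Label} :
    mixedEdge n t ⊆ s ↔ E (t / 2) ∈ s ∧ O (adv n (t / 2) (t % 2)) ∈ s := by
  simp [mixedEdge, insert_subset_iff]

lemma mixedEdge_even {n l : ℕ} {s : Finset Label} (hl : l < n) :
    mixedEdge n (2 * l) ⊆ s ↔ E l ∈ s ∧ O l ∈ s := by
  rw [mixedEdge_subset, Nat.mul_div_cancel_left l two_pos, Nat.mul_mod_right]
  simp [adv, hl]

lemma mixedEdge_odd {n l : ℕ} {s : Finset Label} :
    mixedEdge n (2 * l + 1) ⊆ s ↔ E l ∈ s ∧ O (adv n l 1) ∈ s := by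
  rw [mixedEdge_subset, show (2 * l + 1) / 2 = l by omega, show (2 * l + 1) % 2 = 1 by omega]

lemma mem_cellComplement {n : ℕ} {s : Finset Label} (hs : s ∈ cyc n 1) {x y : ℕ} (hx : E x ∈ s)
    (hy : O y ∈ s) (h : s ≠ {E 0, O 0, O 1}) : s ∈ cellComplement n := by
  refine ⟨hs, h, ?_, ?_⟩
  · rintro rfl
    simp at hy
  · rintro rfl
    simp at hx

lemma stage_insert_odd {n l : ℕ} (hn : 4 ≤ n) {s : Finset Label}
    (hs : s ∈ stage n (2 * l + 1)) (hsub : mixedEdge n (2 * l + 1) ⊆ s) :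
    insert (E (adv n l 1)) s ∈ stage n (2 * l + 1) := by
  rw [mixedEdge_odd] at hsub
  obtain ⟨hE, hO⟩ := hsub
  have hcyc : s ∈ cyc n 1 := hs.1.1
  have hl := hcyc.1.lt_E hE
  have hanch := anchored_of_mem hcyc (by omega) hE hO
  have hOl : O l ∉ s := by
    intro hOl
    rcases Nat.eq_zero_or_pos l with rfl | hpos
    · have hE0 : ∀ x, E x ∈ s → x = 0 := by
        intro x hx
        have := (hanch x 0 hx hOl).1
        exact off_inj hl (hcyc.1.lt_E hx) hl (by rw [off_self] at *; omega)
      have hO01 : ∀ y, O y ∈ s → y = 0 ∨ y = 1 := by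
        intro y hy
        have := (hanch 0 y hE hy).2
        unfold off at this
        split_ifs at this <;> omega
      have h1 : adv n 0 1 = 1 := by
        unfold adv
        split_ifs <;> omega
      rw [h1] at hO
      refine hs.1.2.1 (Subset.antisymm (fun v hv => ?_) ?_)
      · obtain ⟨i, -, rfl | rfl⟩ := hcyc.1 v hv
        · simp [hE0 i hv]
        · rcases hO01 i hv with rfl | rfl <;> simp
      · simp [insert_subset_iff, hE, hO, hOl]
    · exact hs.2 (2 * l) (by omega) (by omega) ((mixedEdge_even hl).2 ⟨hE, hOl⟩)
  have hOy : ∀ y, O y ∈ s → y = adv n l 1 := by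
    intro y hy
    have hyn := hcyc.1.lt_O hy
    have h1 := (hanch l y hE hy).2
    have h0 : off n l y ≠ 0 := fun h =>
      hOl (off_inj hl hyn hl (by rw [h, off_self]) ▸ hy)
    exact off_inj hl hyn (adv_lt hl (by omega)) (by rw [off_adv hl (by omega)]; omega)
  refine ⟨mem_cellComplement (mem_cyc_of_anchored (hcyc.1.insert_E (adv_lt hl (by omega)))
    (mem_insert_of_mem hE) (mem_insert_of_mem hO) fun x y hx hy => ?_) (mem_insert_of_mem hE)
    (mem_insert_of_mem hO) fun h => ?_, fun j hj hjt hsub => ?_⟩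
  · have hy' : O y ∈ s := by simpa using hy
    rcases mem_insert.1 hx with hx | hx
    · obtain rfl : x = adv n l 1 := by simpa using hx
      rw [hOy y hy', off_adv hl (by omega)]
      omega
    · exact hanch x y hx hy'
  · have h1 : E (adv n l 1) ∈ ({E 0, O 0, O 1} : Finset Label) := h ▸ mem_insert_self _ _
    have h2 : E l ∈ ({E 0, O 0, O 1} : Finset Label) := h ▸ mem_insert_of_mem hE
    have := adv_one_ne (n := n) (by omega) l
    simp at h1 h2
    omega
  · have hsub' := mixedEdge_subset.1 hsub
    have hOj : O (adv n (j / 2) (j % 2)) ∈ s := by simpa using hsub'.2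
    rcases mem_insert.1 hsub'.1 with h | h
    · have hj2 : j / 2 = adv n l 1 := by simpa using h
      have h3 := hOy _ hOj
      unfold adv at *
      split_ifs at * <;> omega
    · exact hs.2 j hj hjt (mixedEdge_subset.2 ⟨h, hOj⟩)

lemma stage_insert_even {n l : ℕ} (hn : 4 ≤ n) (hl0 : 1 ≤ l) (hln : l < n) {s : Finset Label}
    (hs : s ∈ stage n (2 * l)) (hsub : mixedEdge n (2 * l) ⊆ s) :
    insert (O (adv n l 1)) s ∈ stage n (2 * l) := by
  rw [mixedEdge_even hln] at hsub
  obtain ⟨hE, hO⟩ := hsub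
  have hcyc : s ∈ cyc n 1 := hs.1.1
  have hpred : E (l - 1) ∉ s := by
    intro h
    refine hs.2 (2 * (l - 1) + 1) (by omega) (by omega) (mixedEdge_odd.2 ⟨h, ?_⟩)
    convert hO using 2
    unfold adv
    split_ifs <;> omega
  have hanch : Anchored n 1 s l := by
    obtain ⟨c, hc, h⟩ := exists_anchored_of_mem_cyc hcyc hE hO
    have hcn := hcyc.1.lt_E hc
    have h1 := (h l l hE hO).2
    obtain rfl | rfl : c = l ∨ c = l - 1 := by
      unfold off at h1
      split_ifs at h1 <;> omega
    · exact h
    · exact absurd hc hpred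
  have hEx : ∀ x, E x ∈ s → x = l := by
    intro x hx
    have := (hanch x l hx hO).1
    exact off_inj hln (hcyc.1.lt_E hx) hln (by rw [off_self] at *; omega)
  refine ⟨mem_cellComplement (mem_cyc_of_anchored (hcyc.1.insert_O (adv_lt hln (by omega)))
    (mem_insert_of_mem hE) (mem_insert_of_mem hO) fun x y hx hy => ?_) (mem_insert_of_mem hE)
    (mem_insert_of_mem hO) fun h => ?_, fun j hj hjt hsub => ?_⟩
  · have hx' : E x ∈ s := by simpa using hx
    rcases mem_insert.1 hy with hy | hy
    · obtain rfl : y = adv n l 1 := by simpa using hy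
      rw [hEx x hx', off_adv hln (by omega), off_self]
      omega
    · exact hanch x y hx' hy
  · have h2 : E l ∈ ({E 0, O 0, O 1} : Finset Label) := h ▸ mem_insert_of_mem hE
    simp at h2
    omega
  · have hEj : E (j / 2) ∈ s := by simpa using (mixedEdge_subset.1 hsub).1
    have := hEx _ hEj
    omega

lemma cellComplement_collapses_stage {n : ℕ} (hn : 4 ≤ n) (t : ℕ) (ht : t + 1 ≤ 2 * n) :
    Collapses (cellComplement n) (stage n (t + 1)) := by
  induction t with
  | zero =>
    have : stage n 1 = cellComplement n := by
      ext s
      refine ⟨fun h => h.1, fun h => ⟨h, fun j h1 h2 => ?_⟩⟩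
      omega
    rw [zero_add, this]
  | succ t ih =>
    have hstep : stage n (t + 1 + 1) = {s ∈ stage n (t + 1) | ¬ mixedEdge n (t + 1) ⊆ s} := by
      ext s
      constructor
      · exact fun h => ⟨⟨h.1, fun j h1 h2 => h.2 j h1 (by omega)⟩, h.2 _ (by omega) (by omega)⟩
      · rintro ⟨⟨h, h'⟩, ht⟩
        refine ⟨h, fun j h1 h2 => ?_⟩
        rcases (Nat.lt_succ_iff_lt_or_eq.1 h2) with h2 | rfl
        · exact h' j h1 h2
        · exact ht
    refine (ih (by omega)).trans ?_
    rw [hstep]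
    obtain ⟨l, hl⟩ := Nat.even_or_odd' (t + 1)
    have hadv := adv_one_ne (n := n) (by omega) l
    rcases hl with hl | hl <;> rw [hl]
    · refine Collapses.single (w := O (adv n l 1)) (insert_nonempty _ _) ?_
        fun s => stage_insert_even hn (by omega) (by omega)
      simp only [mixedEdge, Nat.mul_div_cancel_left l two_pos, Nat.mul_mod_right, mem_insert,
        mem_singleton, reduceCtorEq, false_or, O.injEq]
      unfold adv at *
      split_ifs at * <;> omega
    · refine Collapses.single (w := E (adv n l 1)) (insert_nonempty _ _) ?_
        fun s => stage_insert_odd hn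
      simp only [mixedEdge, show (2 * l + 1) / 2 = l by omega, mem_insert,
        mem_singleton, reduceCtorEq, or_false, E.injEq]
      exact hadv

lemma eq_of_mem_stage_of_mixed {n : ℕ} {s : Finset Label}
    (hs : s ∈ stage n (2 * n)) {x y : ℕ} (hx : E x ∈ s) (hy : O y ∈ s) : s = {E 0, O 0} := by
  have hcyc : s ∈ cyc n 1 := hs.1.1
  obtain ⟨c, hc, h⟩ := exists_anchored_of_mem_cyc hcyc hx hy
  have hcn := hcyc.1.lt_E hc
  have hOc : ∀ y, O y ∈ s → y = c := by
    intro y hy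
    have hyn := hcyc.1.lt_O hy
    have h1 := (h c y hc hy).2
    have h2 : off n c y ≠ 1 := by
      intro h2
      refine hs.2 (2 * c + 1) (by omega) (by omega) (mixedEdge_odd.2 ⟨hc, ?_⟩)
      rwa [← h2, adv_off hcn hyn]
    exact off_inj hcn hyn hcn (by rw [off_self]; omega)
  obtain rfl := hOc y hy
  have h0 : y = 0 := by
    by_contra h0
    exact hs.2 (2 * y) (by omega) (by omega) ((mixedEdge_even hcn).2 ⟨hc, hy⟩)
  subst h0
  have hEc : ∀ x, E x ∈ s → x = 0 := by
    intro x hx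
    have := (h x 0 hx hy).1
    exact off_inj hcn (hcyc.1.lt_E hx) hcn (by rw [off_self] at *; omega)
  refine Subset.antisymm (fun v hv => ?_) (by simp [insert_subset_iff, hc, hy])
  obtain ⟨i, -, rfl | rfl⟩ := hcyc.1 v hv
  · simp [hEc i hv]
  · simp [hOc i hv]

/-- The complement of the three top cells collapses to a point. -/
lemma cellComplement_collapses {n : ℕ} (hn : 4 ≤ n) : Collapses (cellComplement n) {{E 0}} := by
  have c1 := cellComplement_collapses_stage hn (2 * n - 1) (by omega)
  rw [Nat.sub_add_cancel (by omega)] at c1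
  have c2 := Collapses.family (stage n (2 * n)) (Ico 1 n) (fun i => {E i}) (fun _ => E 0)
    (fun i _ => singleton_nonempty _) ?_ ?_ ?_
  have c3 := Collapses.family {s ∈ stage n (2 * n) | ∀ i ∈ Ico 1 n, ¬ {E i} ⊆ s} (Ico 1 n)
    (fun i => {O i}) (fun _ => O 0) (fun i _ => singleton_nonempty _) ?_ ?_ ?_
  · have hsub : ∀ s, s ∈ stage n (2 * n) → (∀ i ∈ Ico 1 n, ¬ {E i} ⊆ s) →
        (∀ i ∈ Ico 1 n, ¬ {O i} ⊆ s) → s ⊆ {E 0, O 0} := by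
      intro s hs hE hO v hv
      simp only [mem_Ico, singleton_subset_iff] at hE hO
      obtain ⟨i, hi, rfl | rfl⟩ := hs.1.1.1 v hv
      · have : i = 0 := by
          by_contra h
          exact hE i ⟨by omega, hi⟩ hv
        simp [this]
      · have : i = 0 := by
          by_contra h
          exact hO i ⟨by omega, hi⟩ hv
        simp [this]
    have hmem : ∀ s : Finset Label, s.Nonempty → s ⊆ {E 0, O 0} → s ∈ stage n (2 * n) := by
      intro s hne hs
      refine ⟨⟨?_, ?_, ?_, ?_⟩, ?_⟩
      · refine cyc_downClosed (by omega) {E 0, O 0} ?_ s hs hne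
        refine mem_cyc_of_anchored (a := 0) (b := 0) ?_ (by simp) (by simp) ?_
        · intro v hv
          refine ⟨0, by omega, by simpa using hv⟩
        · intro x y hx hy
          obtain rfl : x = 0 := by simpa using hx
          obtain rfl : y = 0 := by simpa using hy
          simp [off_self]
      · rintro rfl
        simpa using hs (x := O 1) (by simp)
      · rintro rfl
        have := hs (x := E 1) (mem_image_of_mem _ (mem_Ico.2 ⟨le_rfl, by omega⟩))
        simp at this
      · rintro rfl
        have := hs (x := O 1) (mem_image_of_mem _ (mem_Ico.2 ⟨le_rfl, by omega⟩))
        simp at this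
      · intro j h1 h2 h
        have h' := mixedEdge_subset.1 (h.trans hs)
        simp at h'
        unfold adv at h'
        split_ifs at h' <;> omega
    refine ((c1.trans c2).trans c3).tail ⟨{O 0}, E 0, singleton_nonempty _, by simp, ?_, ?_⟩
    · rintro s ⟨⟨hs, hE⟩, hO⟩ h0
      have := hsub s hs hE hO
      refine ⟨⟨hmem _ (insert_nonempty _ _) ?_, ?_⟩, ?_⟩
      · exact insert_subset (by simp) this
      · intro i hi h
        exact hE i hi (by grind)
      · intro i hi h
        exact hO i hi (by grind)
    · ext s
      constructor
      · rintro rfl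
        exact ⟨⟨⟨hmem _ (singleton_nonempty _) (by simp), by grind⟩, by grind⟩, by simp⟩
      · rintro ⟨⟨⟨hs, hE⟩, hO⟩, h0⟩
        have := hsub s hs hE hO
        have hne := hs.1.1.2.1
        rw [singleton_subset_iff] at h0
        refine (Finset.Nonempty.subset_singleton_iff hne).1 fun v hv => ?_
        have := this hv
        simp only [mem_insert, mem_singleton] at this ⊢
        rcases this with rfl | rfl
        · rfl
        · exact absurd hv h0
  · intro i hi
    simp at hi ⊢
    omega
  · rintro i hi s ⟨hs, hE⟩ his
    rw [mem_Ico] at hi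
    rw [singleton_subset_iff] at his
    have hnoE : ∀ j, E j ∉ s := by
      intro j hj
      have := eq_of_mem_stage_of_mixed hs hj his
      rw [this] at his
      simp at his
      omega
    have hcyc : s ∈ cyc n 1 := hs.1.1
    refine ⟨⟨⟨⟨hcyc.1.insert_O (by omega), insert_nonempty _ _, Or.inr (Or.inl ⟨by simpa, ?_⟩)⟩,
      ?_, ?_, ?_⟩, ?_⟩, ?_⟩
    · by_contra! hall
      have hall' : ∀ j, 1 ≤ j → j < n → O j ∈ s := by
        intro j h1 h2
        have := hall j h2
        rw [mem_insert, O.injEq] at this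
        exact this.resolve_left (by omega)
      have h0 : O 0 ∉ s := by
        intro h0
        rcases hcyc.2.2 with h | ⟨-, j, hj, hjs⟩ | ⟨-, a, ha, -⟩
        · exact h.1 _ his
        · rcases Nat.eq_zero_or_pos j with rfl | hpos
          · exact hjs h0
          · exact hjs (hall' j hpos hj)
        · exact hnoE a ha
      apply hs.1.2.2.2
      ext v
      constructor
      · intro hv
        obtain ⟨j, hj, rfl | rfl⟩ := hcyc.1 v hv
        · exact absurd hv (hnoE j)
        · refine mem_image_of_mem _ (mem_Ico.2 ⟨?_, hj⟩)
          by_contra hlt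
          obtain rfl : j = 0 := by omega
          exact h0 hv
      · intro hv
        obtain ⟨j, hj, rfl⟩ := mem_image.1 hv
        rw [mem_Ico] at hj
        exact hall' j hj.1 hj.2
    · intro h
      have : E 0 ∈ insert (O 0) s := by rw [h]; simp
      simp [hnoE] at this
    · intro h
      have := mem_insert_self (O 0) s
      rw [h] at this
      simp at this
    · intro h
      have := mem_insert_self (O 0) s
      rw [h] at this
      simp at this
    · intro j _ _ h
      have := (mixedEdge_subset.1 h).1
      simp [hnoE] at this
    · intro j _ h
      simp [hnoE] at h
  · intro i hi j hj s hs his hjs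
    simp at hi hj hjs ⊢
    exact hjs.resolve_left (by omega)
  · intro i hi
    simp at hi ⊢
    omega
  · rintro i hi s hs his
    rw [mem_Ico] at hi
    rw [singleton_subset_iff] at his
    have hnoO : ∀ j, O j ∉ s := by
      intro j hj
      have := eq_of_mem_stage_of_mixed hs his hj
      rw [this] at his
      simp at his
      omega
    have hcyc : s ∈ cyc n 1 := hs.1.1
    refine ⟨⟨⟨hcyc.1.insert_E (by omega), insert_nonempty _ _, Or.inl ⟨by simpa, ?_⟩⟩,
      ?_, ?_, ?_⟩, ?_⟩
    · by_contra! hall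
      have hall' : ∀ j, 1 ≤ j → j < n → E j ∈ s := by
        intro j h1 h2
        have := hall j h2
        rw [mem_insert, E.injEq] at this
        exact this.resolve_left (by omega)
      have h0 : E 0 ∉ s := by
        intro h0
        rcases hcyc.2.2 with ⟨-, j, hj, hjs⟩ | h | ⟨⟨a, ha⟩, -⟩
        · rcases Nat.eq_zero_or_pos j with rfl | hpos
          · exact hjs h0
          · exact hjs (hall' j hpos hj)
        · exact h.1 _ his
        · exact hnoO a ha
      apply hs.1.2.2.1
      ext v
      constructor
      · intro hv
        obtain ⟨j, hj, rfl | rfl⟩ := hcyc.1 v hv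
        · refine mem_image_of_mem _ (mem_Ico.2 ⟨?_, hj⟩)
          by_contra hlt
          obtain rfl : j = 0 := by omega
          exact h0 hv
        · exact absurd hv (hnoO j)
      · intro hv
        obtain ⟨j, hj, rfl⟩ := mem_image.1 hv
        rw [mem_Ico] at hj
        exact hall' j hj.1 hj.2
    · intro h
      have : O 0 ∈ insert (E 0) s := by rw [h]; simp
      simp [hnoO] at this
    · intro h
      have := mem_insert_self (E 0) s
      rw [h] at this
      simp at this
    · intro h
      have := mem_insert_self (E 0) s
      rw [h] at this
      simp at this
    · intro j _ _ h
      have := (mixedEdge_subset.1 h).2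
      simp [hnoO] at this
  · intro i hi j hj s hs his hjs
    simp at hi hj hjs ⊢
    exact hjs.resolve_left (by omega)

end CellComplement

section Wedge

open Label

lemma cells_mem_cyc {n : ℕ} (hn : 4 ≤ n) : ({E 0, O 0, O 1} : Finset Label) ∈ cyc n 1 ∧
    (Ico 1 n).image E ∈ cyc n 1 ∧ (Ico 1 n).image O ∈ cyc n 1 := by
  refine ⟨mem_cyc_of_anchored (a := 0) (b := 0) ?_ (by simp) (by simp) ?_, ⟨?_, ?_, ?_⟩,
    ⟨?_, ?_, ?_⟩⟩
  · intro v hv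
    simp only [mem_insert, mem_singleton] at hv
    rcases hv with rfl | rfl | rfl
    · exact ⟨0, by omega, Or.inl rfl⟩
    · exact ⟨0, by omega, Or.inr rfl⟩
    · exact ⟨1, by omega, Or.inr rfl⟩
  · intro x y hx hy
    obtain rfl : x = 0 := by simpa using hx
    have hy' : y = 0 ∨ y = 1 := by simpa using hy
    rcases hy' with rfl | rfl <;> simp [off]
  · intro v hv
    obtain ⟨i, hi, rfl⟩ := mem_image.1 hv
    exact ⟨i, (mem_Ico.1 hi).2, Or.inl rfl⟩
  · exact (nonempty_Ico.2 (by omega)).image _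
  · exact Or.inl ⟨by simp, 0, by omega, by simp⟩
  · intro v hv
    obtain ⟨i, hi, rfl⟩ := mem_image.1 hv
    exact ⟨i, (mem_Ico.1 hi).2, Or.inr rfl⟩
  · exact (nonempty_Ico.2 (by omega)).image _
  · exact Or.inr (Or.inl ⟨by simp, 0, by omega, by simp⟩)

/-- The three distinguished cells are facets of `cyc n 1`. -/
lemma cells_maximal {n : ℕ} (hn : 4 ≤ n) {s : Finset Label} (hs : s ∈ cyc n 1) :
    ({E 0, O 0, O 1} ⊆ s → s = {E 0, O 0, O 1}) ∧
    ((Ico 1 n).image E ⊆ s → s = (Ico 1 n).image E) ∧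
    ((Ico 1 n).image O ⊆ s → s = (Ico 1 n).image O) := by
  refine ⟨fun h => ?_, fun h => ?_, fun h => ?_⟩
  · simp only [insert_subset_iff, singleton_subset_iff] at h
    have h1 : adv n 0 1 = 1 := by
      unfold adv
      split_ifs <;> omega
    have hanch := anchored_of_mem hs (by omega) h.1 (by rw [h1]; exact h.2.2)
    refine Subset.antisymm (fun v hv => ?_) (by simp [insert_subset_iff, h])
    obtain ⟨i, -, rfl | rfl⟩ := hs.1 v hv
    · have := (hanch i 0 hv h.2.1).1
      obtain rfl : i = 0 := by simpa [off] using this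
      simp
    · have := (hanch 0 i h.1 hv).2
      obtain rfl | rfl : i = 0 ∨ i = 1 := by
        simp [off] at this
        omega
      · simp
      · simp
  · have hmem : ∀ j, 1 ≤ j → j < n → E j ∈ s := fun j h1 h2 =>
      h (mem_image_of_mem _ (mem_Ico.2 ⟨h1, h2⟩))
    have hO : ∀ b, O b ∉ s := by
      intro b hb
      obtain ⟨c, hc, hanch⟩ := exists_anchored_of_mem_cyc hs (hmem 1 le_rfl (by omega)) hb
      have hcn := hs.1.lt_E hc
      have h1 := hanch 1 b (hmem 1 le_rfl (by omega)) hb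
      have h2 := hanch 2 b (hmem 2 (by omega) (by omega)) hb
      have h3 := hanch 3 b (hmem 3 (by omega) (by omega)) hb
      unfold off at h1 h2 h3
      split_ifs at h1 h2 h3 <;> omega
    refine Subset.antisymm (fun v hv => ?_) h
    obtain ⟨i, hi, rfl | rfl⟩ := hs.1 v hv
    · refine mem_image_of_mem _ (mem_Ico.2 ⟨?_, hi⟩)
      by_contra hlt
      obtain rfl : i = 0 := by omega
      rcases hs.2.2 with ⟨-, j, hj, hjs⟩ | h' | ⟨⟨b, hb⟩, -⟩
      · rcases Nat.eq_zero_or_pos j with rfl | hpos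
        · exact hjs hv
        · exact hjs (hmem j hpos hj)
      · exact h'.1 0 hv
      · exact hO b hb
    · exact absurd hv (hO i)
  · have hmem : ∀ j, 1 ≤ j → j < n → O j ∈ s := fun j h1 h2 =>
      h (mem_image_of_mem _ (mem_Ico.2 ⟨h1, h2⟩))
    have hE : ∀ b, E b ∉ s := by
      intro b hb
      obtain ⟨c, hc, hanch⟩ := exists_anchored_of_mem_cyc hs hb (hmem 1 le_rfl (by omega))
      have hcn := hs.1.lt_E hc
      have h1 := hanch c 1 hc (hmem 1 le_rfl (by omega))
      have h2 := hanch c 2 hc (hmem 2 (by omega) (by omega))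
      have h3 := hanch c 3 hc (hmem 3 (by omega) (by omega))
      unfold off at h1 h2 h3
      split_ifs at h1 h2 h3 <;> omega
    refine Subset.antisymm (fun v hv => ?_) h
    obtain ⟨i, hi, rfl | rfl⟩ := hs.1 v hv
    · exact absurd hv (hE i)
    · refine mem_image_of_mem _ (mem_Ico.2 ⟨?_, hi⟩)
      by_contra hlt
      obtain rfl : i = 0 := by omega
      rcases hs.2.2 with h' | ⟨-, j, hj, hjs⟩ | ⟨-, a, ha, -⟩
      · exact h'.1 0 hv
      · rcases Nat.eq_zero_or_pos j with rfl | hpos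
        · exact hjs hv
        · exact hjs (hmem j hpos hj)
      · exact hE a ha

lemma cellComplement_downClosed {n : ℕ} (hn : 4 ≤ n) : DownClosed (cellComplement n) := by
  rintro s ⟨hs, h1, h2, h3⟩ t hts ht
  have hmax := cells_maximal hn hs
  refine ⟨cyc_downClosed (by omega) s hs t hts ht, ?_, ?_, ?_⟩
  · rintro rfl
    exact h1 (hmax.1 hts)
  · rintro rfl
    exact h2 (hmax.2.1 hts)
  · rintro rfl
    exact h3 (hmax.2.2 hts)

/-- The combinatorial model is homotopy equivalent to a wedge of spheres. -/
theorem geom_cyc_homotopyEquiv_wedge {n : ℕ} (hn : 4 ≤ n) :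
    ∃ (p : NSphere 2) (q₁ q₂ : NSphere (n - 2)),
      Nonempty (ContinuousMap.HomotopyEquiv (geom (cyc n (n - 3)))
        (Wedge3 (NSphere 2) (NSphere (n - 2)) (NSphere (n - 2)) p q₁ q₂)) := by
  have hP : ∀ s ∈ cyc n 1, P ∉ s := by
    intro s hs h
    obtain ⟨i, -, h | h⟩ := hs.1 _ h <;> cases h
  have hdc : DownClosed (attachCone (cyc n 1) (cellComplement n) P) :=
    (cyc_downClosed (by omega)).attachCone (cellComplement_downClosed hn) fun s hs => hs.1
  obtain ⟨hF, hG, hH⟩ := cells_mem_cyc hn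
  have e1 : (1 : ℕ) ∈ Ico 1 n := mem_Ico.2 ⟨le_rfl, by omega⟩
  have e2 : (2 : ℕ) ∈ Ico 1 n := mem_Ico.2 ⟨by omega, by omega⟩
  have c := collapses_attachCone_withoutCells (p := P) (U := (range n).image E ∪ (range n).image O)
    (cyc_downClosed (by omega)) (fun s hs v hv => ?_) (fun s hs => hs.2.1) (by simp) hF hG hH
    (fun h => by simpa using h (x := O 0) (by simp))
    (fun h => by simpa using h (x := E 0) (by simp))
    (fun h => by simpa using h (mem_image_of_mem E e1))
    (fun h => by simpa using h (mem_image_of_mem E e1))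
    (fun h => by simpa using h (mem_image_of_mem O e2))
    (fun h => by simpa using h (mem_image_of_mem O e1))
  · obtain ⟨f₁⟩ := Collapses.homotopyEquiv (cyc_collapses_one hn) (cyc_downClosed (by omega))
    obtain ⟨f₂⟩ := Collapses.homotopyEquiv (collapses_of_attachCone (p := P) (c := E 0) (by simp) hP
      (fun s hs => hP s hs.1) (cellComplement_collapses hn)) hdc
    obtain ⟨f₃⟩ := Collapses.homotopyEquiv c hdc
    have hedge : ({P, O 1} : Finset Label) ⊂ insert P ((Ico 1 n).image O) := by
      refine Finset.ssubset_iff_subset_ne.2 ⟨?_, fun h => ?_⟩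
      · exact insert_subset_insert _ (singleton_subset_iff.2 (mem_image_of_mem _ e1))
      · have : O 2 ∈ insert P ((Ico 1 n).image O) := mem_insert_of_mem (mem_image_of_mem _ e2)
        rw [← h] at this
        simp at this
    have hR : ∀ s ∈ properFaces (insert P ((Ico 1 n).image E)) ∪
        properFaces (insert P ((Ico 1 n).image O)), E 0 ∉ s ∧ O 0 ∉ s ∧ Q ∉ s := by
      rintro s (hs | hs)
      all_goals
        refine ⟨fun h => ?_, fun h => ?_, fun h => ?_⟩
        all_goals simpa using hs.2.subset h
    obtain ⟨f₄⟩ := homotopyEquiv_replace_vertex (p := P) (e := E 0) (o := O 0) (z := O 1) (q := Q)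
      ((properFaces_downClosed (insert P ((Ico 1 n).image E))).union
        (properFaces_downClosed (insert P ((Ico 1 n).image O))))
      (Or.inr ⟨insert_nonempty _ _, hedge⟩) (fun s hs => (hR s hs).1) (fun s hs => (hR s hs).2.1)
      (fun s hs => (hR s hs).2.2)
      (by simp) (by simp) (by simp) (by simp) (by simp) (by simp) (by simp) (by simp) (by simp)
    rw [← Set.union_assoc, ← Set.union_assoc] at f₄
    have hcardE : (insert P ((Ico 1 n).image E)).card = n - 2 + 2 := by
      rw [card_insert_of_notMem (by simp), card_image_of_injective _ fun _ _ h => by simpa using h,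
        Nat.card_Ico]
      omega
    have hcardO : (insert P ((Ico 1 n).image O)).card = n - 2 + 2 := by
      rw [card_insert_of_notMem (by simp), card_image_of_injective _ fun _ _ h => by simpa using h,
        Nat.card_Ico]
      omega
    obtain ⟨x, y, z, ⟨f₅⟩⟩ := geom_homeomorph_wedge (a := 2) (F := {P, E 0, O 0, Q}) (p := P) rfl
      hcardE hcardO (by ext v; cases v <;> simp) (by ext v; cases v <;> simp)
      (by ext v; cases v <;> simp)
    exact ⟨x, y, z, ⟨(((f₁.trans f₂.symm).trans f₃).trans f₄).trans f₅.toHomotopyEquiv⟩⟩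
  · obtain ⟨i, hi, rfl | rfl⟩ := hs.1 v hv
    · exact mem_union_left _ (mem_image_of_mem _ (mem_range.2 hi))
    · exact mem_union_right _ (mem_image_of_mem _ (mem_range.2 hi))

end Wedge

/-! ### The Hasse diagram of a cycle -/

section CycleHasse

lemma cycleGraph_adj_iff {n : ℕ} (hn : 4 ≤ n) {u v : Fin n} :
    (SimpleGraph.cycleGraph n).Adj u v ↔ v.val = adv n u.val 1 ∨ u.val = adv n v.val 1 := by
  have hu := u.isLt
  have hv := v.isLt
  rw [SimpleGraph.cycleGraph_adj', Fin.sub_def, Fin.sub_def]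
  have key : ∀ a b : ℕ, a < n → b < n → ((n - b + a) % n = 1 ↔ a = adv n b 1) := by
    intro a b ha hb
    unfold adv
    by_cases h : a < b
    · rw [Nat.mod_eq_of_lt (by omega)]
      split_ifs <;> omega
    · rw [show n - b + a = a - b + n by omega, Nat.add_mod_right, Nat.mod_eq_of_lt (by omega)]
      split_ifs <;> omega
  simp only [key _ _ hu hv, key _ _ hv hu]
  tauto

variable (n : ℕ) [NeZero n]

/-- The arc from the edge of the cycle at `i` to its initial node. -/
def fwdArc (i : ℕ) : Finset (Fin n) × Finset (Fin n) :=
  ({Fin.ofNat n i, Fin.ofNat n (adv n i 1)}, {Fin.ofNat n i})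

/-- The arc from the edge of the cycle at `i` to its terminal node. -/
def bwdArc (i : ℕ) : Finset (Fin n) × Finset (Fin n) :=
  ({Fin.ofNat n i, Fin.ofNat n (adv n i 1)}, {Fin.ofNat n (adv n i 1)})

variable {n}

lemma ofNat_inj {i j : ℕ} (hi : i < n) (hj : j < n) (h : Fin.ofNat n i = Fin.ofNat n j) :
    i = j := by
  have := congrArg Fin.val h
  simpa [Fin.ofNat, Nat.mod_eq_of_lt hi, Nat.mod_eq_of_lt hj] using this

lemma ofNat_val (v : Fin n) : Fin.ofNat n v.val = v := by
  ext
  simp [Fin.ofNat, Nat.mod_eq_of_lt v.isLt]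

lemma ofNat_ne_ofNat_adv (hn : 4 ≤ n) {i : ℕ} (hi : i < n) :
    Fin.ofNat n i ≠ Fin.ofNat n (adv n i 1) :=
  fun h => adv_one_ne (by omega) i (ofNat_inj hi (adv_lt hi (by omega)) h).symm

lemma edge_inj (hn : 4 ≤ n) {i j : ℕ} (hi : i < n) (hj : j < n)
    (h : (fwdArc n i).1 = (fwdArc n j).1) : i = j := by
  have hi' : adv n i 1 < n := adv_lt hi (by omega)
  have hj' : adv n j 1 < n := adv_lt hj (by omega)
  simp only [fwdArc] at h
  have h1 : Fin.ofNat n i ∈ ({Fin.ofNat n j, Fin.ofNat n (adv n j 1)} : Finset (Fin n)) :=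
    h ▸ mem_insert_self _ _
  have h2 : Fin.ofNat n (adv n i 1) ∈
      ({Fin.ofNat n j, Fin.ofNat n (adv n j 1)} : Finset (Fin n)) :=
    h ▸ mem_insert_of_mem (mem_singleton_self _)
  rw [mem_insert, mem_singleton] at h1 h2
  rcases h1 with h1 | h1
  · exact ofNat_inj hi hj h1
  · have h1 := ofNat_inj hi hj' h1
    rcases h2 with h2 | h2
    · have h2 := ofNat_inj hi' hj h2
      unfold adv at *
      split_ifs at * <;> omega
    · have h2 := ofNat_inj hi' hj' h2
      unfold adv at *
      split_ifs at * <;> omega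

lemma fwdArc_ne_bwdArc (hn : 4 ≤ n) {i j : ℕ} (hi : i < n) (hj : j < n) :
    fwdArc n i ≠ bwdArc n j := by
  intro h
  have h1 : (fwdArc n i).1 = (bwdArc n j).1 := congrArg Prod.fst h
  obtain rfl := edge_inj hn hi hj h1
  exact ofNat_ne_ofNat_adv hn hi (singleton_injective (congrArg Prod.snd h))

lemma mem_graphComplex {V : Type} [Fintype V] [DecidableEq V] {G : SimpleGraph V}
    {s : Finset V} :
    s ∈ graphComplex G ↔ (∃ v, s = {v}) ∨ ∃ u v, G.Adj u v ∧ s = {u, v} := by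
  simp [graphComplex]

/-- The arcs of the Hasse diagram of a cycle. -/
lemma hasseArc_cycle_iff (hn : 4 ≤ n) {g f : Finset (Fin n)} :
    HasseArc (graphComplex (SimpleGraph.cycleGraph n)) g f ↔
      ∃ i < n, (g, f) = fwdArc n i ∨ (g, f) = bwdArc n i := by
  constructor
  · rintro ⟨hg, hf, hfg, hcard⟩
    obtain ⟨i, hi, rfl⟩ : ∃ i < n, g = (fwdArc n i).1 := by
      rcases mem_graphComplex.1 hg with ⟨v, rfl⟩ | ⟨u, v, huv, rfl⟩
      · rw [card_singleton] at hcard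
        have hf0 : f = ∅ := card_eq_zero.1 (by omega)
        rcases mem_graphComplex.1 hf with ⟨w, rfl⟩ | ⟨w, w', -, rfl⟩
        · simp at hf0
        · simp at hf0
      · rcases (cycleGraph_adj_iff hn).1 huv with h | h
        · exact ⟨u.val, u.isLt, by simp only [fwdArc, ← h, ofNat_val]⟩
        · exact ⟨v.val, v.isLt, by simp only [fwdArc, ← h, ofNat_val, pair_comm]⟩
    refine ⟨i, hi, ?_⟩
    have hc2 : (fwdArc n i).1.card = 2 := card_pair (ofNat_ne_ofNat_adv hn hi)
    obtain ⟨w, rfl⟩ := card_eq_one.1 (show f.card = 1 by omega)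
    have hw := hfg.subset (mem_singleton_self w)
    simp only [fwdArc, mem_insert, mem_singleton] at hw
    rcases hw with rfl | rfl
    · exact Or.inl rfl
    · exact Or.inr rfl
  · rintro ⟨i, hi, h⟩
    have hne := ofNat_ne_ofNat_adv hn hi
    have hadv : adv n i 1 < n := adv_lt hi (by omega)
    have hedge : ({Fin.ofNat n i, Fin.ofNat n (adv n i 1)} : Finset (Fin n)) ∈
        graphComplex (SimpleGraph.cycleGraph n) := by
      refine mem_graphComplex.2 (Or.inr ⟨_, _, (cycleGraph_adj_iff hn).2 (Or.inl ?_), rfl⟩)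
      simp [Fin.ofNat, Nat.mod_eq_of_lt hi, Nat.mod_eq_of_lt hadv]
    rcases h with h | h
    · obtain ⟨rfl, rfl⟩ := Prod.mk.inj h
      refine ⟨hedge, mem_graphComplex.2 (Or.inl ⟨_, rfl⟩), ?_,
        by rw [card_pair hne, card_singleton]⟩
      exact Finset.ssubset_iff_subset_ne.2 ⟨by simp, fun h => by
        have hc := congrArg card h
        rw [card_singleton, card_pair hne] at hc
        omega⟩
    · obtain ⟨rfl, rfl⟩ := Prod.mk.inj h
      refine ⟨hedge, mem_graphComplex.2 (Or.inl ⟨_, rfl⟩), ?_,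
        by rw [card_pair hne, card_singleton]⟩
      exact Finset.ssubset_iff_subset_ne.2 ⟨by simp, fun h => by
        have hc := congrArg card h
        rw [card_singleton, card_pair hne] at hc
        omega⟩

/-! ### Morse matchings on a cycle -/

section Morse

variable {M : Finset (Finset (Fin n) × Finset (Fin n))}

lemma bwdArc_notMem_of_fwdArc_mem (hn : 4 ≤ n)
    (hM : IsMorseMatching (graphComplex (SimpleGraph.cycleGraph n)) (M : Set _)) {i : ℕ}
    (hi : i < n) (h : fwdArc n i ∈ M) : bwdArc n i ∉ M :=
  fun h' => (hM.2.1 _ h _ h' (fwdArc_ne_bwdArc hn hi hi)).1 rfl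

lemma fwdArc_adv_notMem_of_bwdArc_mem (hn : 4 ≤ n)
    (hM : IsMorseMatching (graphComplex (SimpleGraph.cycleGraph n)) (M : Set _)) {i : ℕ}
    (hi : i < n) (h : bwdArc n i ∈ M) : fwdArc n (adv n i 1) ∉ M :=
  fun h' => (hM.2.1 _ h' _ h (fwdArc_ne_bwdArc hn (adv_lt hi (by omega)) hi)).2.2.2 rfl

/-- The edges of the cycle matched by `M` with one of their nodes. -/
def matchedEdges (M : Finset (Finset (Fin n) × Finset (Fin n))) : Finset ℕ :=
  (range n).filter fun i => fwdArc n i ∈ M ∨ bwdArc n i ∈ M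

lemma card_matchedEdges (hn : 4 ≤ n)
    (hM : IsMorseMatching (graphComplex (SimpleGraph.cycleGraph n)) (M : Set _)) :
    (matchedEdges M).card = M.card := by
  have h1 : M.image Prod.fst = (matchedEdges M).image fun i => (fwdArc n i).1 := by
    ext g
    simp only [mem_image, matchedEdges, mem_filter, mem_range]
    constructor
    · rintro ⟨⟨g, f⟩, hp, rfl⟩
      obtain ⟨i, hi, h | h⟩ := (hasseArc_cycle_iff hn).1 (hM.1 _ hp)
      · exact ⟨i, ⟨hi, Or.inl (h ▸ hp)⟩, (congrArg Prod.fst h).symm⟩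
      · exact ⟨i, ⟨hi, Or.inr (h ▸ hp)⟩, (congrArg Prod.fst h).symm⟩
    · rintro ⟨i, ⟨hi, h | h⟩, rfl⟩
      · exact ⟨_, h, rfl⟩
      · exact ⟨_, h, rfl⟩
  rw [← card_image_of_injOn (s := M) (f := Prod.fst), h1, card_image_of_injOn]
  · intro i hi j hj h
    simp only [matchedEdges, coe_filter, mem_range, Set.mem_ofPred_eq] at hi hj
    exact edge_inj hn hi.1 hj.1 h
  · intro p hp q hq h
    by_contra hne
    exact (hM.2.1 p hp q hq hne).1 h

lemma transGen_of_forall_step {α : Type} {r : α → α → Prop} (v : ℕ → α)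
    (h : ∀ i, Relation.TransGen r (v i) (v (i + 1))) (m : ℕ) :
    Relation.TransGen r (v 0) (v (m + 1)) := by
  induction m with
  | zero => exact h 0
  | succ m ih => exact ih.trans (h _)

/-- A Morse matching leaves some edge of the cycle unmatched. -/
lemma exists_notMem_matchedEdges (hn : 4 ≤ n)
    (hM : IsMorseMatching (graphComplex (SimpleGraph.cycleGraph n)) (M : Set _)) :
    ∃ i < n, i ∉ matchedEdges M := by
  by_contra! hall
  have hor : ∀ i < n, fwdArc n i ∈ M ∨ bwdArc n i ∈ M := fun i hi => (mem_filter.1 (hall i hi)).2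
  have hmod : ∀ i, adv n (i % n) 1 = (i + 1) % n := by
    intro i
    have := Nat.mod_lt i (show 0 < n by omega)
    rw [Nat.add_mod, Nat.mod_eq_of_lt (show 1 < n by omega)]
    unfold adv
    split_ifs with h
    · rw [Nat.mod_eq_of_lt h]
    · rw [show i % n + 1 = n by omega]
      simp
  have hlt : ∀ i, i % n < n := fun i => Nat.mod_lt i (by omega)
  have hfwd : ∀ i < n, HasseArc (graphComplex (SimpleGraph.cycleGraph n)) (fwdArc n i).1
      (fwdArc n i).2 := fun i hi => (hasseArc_cycle_iff hn).2 ⟨i, hi, Or.inl rfl⟩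
  have hbwd : ∀ i < n, HasseArc (graphComplex (SimpleGraph.cycleGraph n)) (bwdArc n i).1
      (bwdArc n i).2 := fun i hi => (hasseArc_cycle_iff hn).2 ⟨i, hi, Or.inr rfl⟩
  by_cases hB : ∃ b < n, bwdArc n b ∈ M
  · obtain ⟨b, hb, hbM⟩ := hB
    have hball : ∀ k, bwdArc n ((b + k) % n) ∈ M := by
      intro k
      induction k with
      | zero => rwa [add_zero, Nat.mod_eq_of_lt hb]
      | succ k ih =>
        have := fwdArc_adv_notMem_of_bwdArc_mem hn hM (hlt _) ih
        rw [hmod] at this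
        exact (hor _ (hlt _)).resolve_left this
    have hall' : ∀ i < n, bwdArc n i ∈ M := by
      intro i hi
      have := hball (n - b + i)
      rwa [show b + (n - b + i) = i + n by omega, Nat.add_mod_right, Nat.mod_eq_of_lt hi] at this
    have hcyc := transGen_of_forall_step
      (r := fun x y => MorseStep (graphComplex (SimpleGraph.cycleGraph n)) (M : Set _) y x)
      (fun i => {Fin.ofNat n (i % n)}) (fun i => ?_) (n - 1)
    · rw [Nat.sub_add_cancel (by omega), Nat.mod_self, Nat.zero_mod] at hcyc
      exact hM.2.2 _ (Relation.transGen_swap.1 hcyc)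
    · have hi := hlt i
      refine Relation.TransGen.tail (b := (fwdArc n (i % n)).1) (Relation.TransGen.single ?_) ?_
      · exact Or.inl ⟨hfwd _ hi, fun h => bwdArc_notMem_of_fwdArc_mem hn hM hi h (hall' _ hi)⟩
      · refine Or.inr ⟨?_, ?_⟩
        · rw [← hmod]
          exact hall' _ hi
        · rw [← hmod]
          exact hbwd _ hi
  · push Not at hB
    have hall' : ∀ i < n, fwdArc n i ∈ M := fun i hi => (hor i hi).resolve_right (hB i hi)
    have hcyc := transGen_of_forall_step
      (r := MorseStep (graphComplex (SimpleGraph.cycleGraph n)) (M : Set _))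
      (fun i => {Fin.ofNat n (i % n)}) (fun i => ?_) (n - 1)
    · rw [Nat.sub_add_cancel (by omega), Nat.mod_self, Nat.zero_mod] at hcyc
      exact hM.2.2 _ hcyc
    · have hi := hlt i
      refine Relation.TransGen.tail (b := (fwdArc n (i % n)).1) (Relation.TransGen.single ?_) ?_
      · exact Or.inr ⟨hall' _ hi, hfwd _ hi⟩
      · rw [← hmod]
        exact Or.inl ⟨hbwd _ hi, hB _ hi⟩

lemma card_lt_of_isMorseMatching (hn : 4 ≤ n)
    (hM : IsMorseMatching (graphComplex (SimpleGraph.cycleGraph n)) (M : Set _)) : M.card < n := by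
  obtain ⟨i, hi, hiM⟩ := exists_notMem_matchedEdges hn hM
  rw [← card_matchedEdges hn hM]
  calc (matchedEdges M).card < (range n).card :=
        card_lt_card ((ssubset_iff_of_subset (filter_subset _ _)).2 ⟨i, mem_range.2 hi, hiM⟩)
    _ = n := card_range n

/-- In a Morse matching with `n - 1` arcs, going around the cycle from the unmatched edge, the
arcs to initial nodes precede the arcs to terminal nodes. -/
lemma exists_block_of_card (hn : 4 ≤ n)
    (hM : IsMorseMatching (graphComplex (SimpleGraph.cycleGraph n)) (M : Set _))
    (hcard : n - 1 ≤ M.card) : ∃ a < n, ∃ k < n,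
      (∀ i < n, fwdArc n i ∈ M → off n a i < k) ∧
      ∀ i < n, bwdArc n i ∈ M → k ≤ off n a i ∧ off n a i + 1 < n := by
  classical
  obtain ⟨e, he, heM⟩ := exists_notMem_matchedEdges hn hM
  have honly : ∀ i < n, i ≠ e → fwdArc n i ∈ M ∨ bwdArc n i ∈ M := by
    intro i hi hie
    by_contra h
    have hsub : matchedEdges M ⊆ ((range n).erase e).erase i := by
      intro j hj
      refine mem_erase.2 ⟨?_, mem_erase.2 ⟨fun h => heM (h ▸ hj), (mem_filter.1 hj).1⟩⟩
      rintro rfl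
      exact h (mem_filter.1 hj).2
    have := card_le_card hsub
    rw [card_erase_of_mem (mem_erase.2 ⟨hie, mem_range.2 hi⟩),
      card_erase_of_mem (mem_range.2 he), card_range, card_matchedEdges hn hM] at this
    omega
  have hea : ∀ i < n, off n (adv n e 1) i + 1 = n → i = e := by
    intro i hi h
    unfold off adv at h
    split_ifs at h <;> omega
  have ha : adv n e 1 < n := adv_lt he (by omega)
  have hex : ∃ k, k = n - 1 ∨ bwdArc n (adv n (adv n e 1) k) ∈ M := ⟨n - 1, Or.inl rfl⟩
  have hkn : Nat.find hex ≤ n - 1 := Nat.find_min' hex (Or.inl rfl)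
  refine ⟨adv n e 1, ha, Nat.find hex, by omega, ?_, ?_⟩
  · intro i hi hiM
    by_contra! hle
    have hstep : ∀ j, Nat.find hex ≤ j → j + 1 < n →
        bwdArc n (adv n (adv n e 1) j) ∈ M := by
      intro j hj
      induction j, hj using Nat.le_induction with
      | base =>
        intro hlt
        exact (Nat.find_spec hex).resolve_left (by omega)
      | succ j hj ih =>
        intro hlt
        have h1 := fwdArc_adv_notMem_of_bwdArc_mem hn hM (adv_lt ha (by omega)) (ih (by omega))
        have h2 : adv n (adv n (adv n e 1) j) 1 = adv n (adv n e 1) (j + 1) := by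
          generalize adv n e 1 = a at *
          unfold adv
          split_ifs <;> omega
        rw [h2] at h1
        refine (honly _ (adv_lt ha (by omega)) fun h => ?_).resolve_left h1
        have h3 := off_adv (k := j + 1) ha (by omega)
        rw [h] at h3
        unfold off adv at h3
        split_ifs at h3 <;> omega
    have hlt : off n (adv n e 1) i + 1 < n := by
      have h1 := off_lt ha hi
      have h2 : off n (adv n e 1) i + 1 ≠ n := fun h =>
        heM (mem_filter.2 ⟨mem_range.2 he, Or.inl (hea i hi h ▸ hiM)⟩)
      omega
    have := hstep _ hle hlt
    rw [adv_off ha hi] at this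
    exact bwdArc_notMem_of_fwdArc_mem hn hM hi hiM this
  · intro i hi hiM
    refine ⟨Nat.find_min' hex (Or.inr ?_), ?_⟩
    · rwa [adv_off ha hi]
    · have h1 := off_lt ha hi
      have h2 : off n (adv n e 1) i + 1 ≠ n := fun h =>
        heM (mem_filter.2 ⟨mem_range.2 he, Or.inr (hea i hi h ▸ hiM)⟩)
      omega

end Morse

end CycleHasse

/-! ### Comparing realizations -/

section Comparison

variable {α W : Type} (φ : α → W) (U : Finset α)

/-- The coordinates on `W` restricted to the vertices in `U`. -/
def pullCoord [DecidableEq α] (y : W → ℝ) (v : α) : ℝ := if v ∈ U then y (φ v) else 0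

/-- The coordinates on `α` pushed forward to `W`. -/
def pushCoord [DecidableEq W] (x : α → ℝ) (w : W) : ℝ := ∑ v ∈ U with φ v = w, x v

variable {φ U}

lemma pushCoord_apply [DecidableEq W] (hφ : Set.InjOn φ U) (x : α → ℝ) {v : α} (hv : v ∈ U) :
    pushCoord φ U x (φ v) = x v := by
  have : ({u ∈ U | φ u = φ v} : Finset α) = {v} := by
    ext u
    rw [mem_filter, mem_singleton]
    exact ⟨fun h => hφ h.1 hv h.2, by rintro rfl; exact ⟨hv, rfl⟩⟩
  rw [pushCoord, this, sum_singleton]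

lemma pushCoord_eq_zero [DecidableEq W] (x : α → ℝ) {w : W} (hw : ∀ v ∈ U, φ v ≠ w) :
    pushCoord φ U x w = 0 := by
  rw [pushCoord, filter_false_of_mem hw, sum_empty]

lemma continuous_pullCoord [DecidableEq α] : Continuous (pullCoord φ U) := by
  refine continuous_pi fun v => ?_
  unfold pullCoord
  split_ifs
  · exact continuous_apply _
  · exact continuous_const

lemma continuous_pushCoord [DecidableEq W] : Continuous (pushCoord φ U) :=
  continuous_pi fun _ => continuous_finsetSum _ fun _ _ => continuous_apply _

variable [Fintype W] [DecidableEq W] {K : Finset (Finset W)} {L : Set (Finset α)}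

lemma pullCoord_mem [DecidableEq α] (hφ : Set.InjOn φ U) (hU : ∀ s ∈ L, s ⊆ U)
    (hKL : ∀ M, M ∈ K ↔ ∃ s ∈ L, s.image φ = M) {y : W → ℝ} (hy : y ∈ realization K) :
    pullCoord φ U y ∈ geom L := by
  obtain ⟨h0, h1, M, hM, hsupp⟩ := hy
  obtain ⟨s, hs, rfl⟩ := (hKL M).1 hM
  have hsU := hU s hs
  refine ⟨s, hs, fun v => ?_, fun v hv => ?_, ?_⟩
  · unfold pullCoord
    split_ifs
    · exact h0 _
    · exact le_rfl
  · unfold pullCoord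
    split_ifs with hvU
    · by_contra hne
      obtain ⟨u, hu, huv⟩ := mem_image.1 ((hsupp _).1 hne)
      exact hv (hφ (hsU hu) hvU huv ▸ hu)
    · rfl
  · calc ∑ v ∈ s, pullCoord φ U y v = ∑ v ∈ s, y (φ v) :=
          sum_congr rfl fun v hv => if_pos (hsU hv)
      _ = ∑ w ∈ s.image φ, y w :=
          (sum_image fun u hu v hv h => hφ (hsU hu) (hsU hv) h).symm
      _ = ∑ w, y w := sum_subset (subset_univ _) fun w _ hw =>
          not_not.1 fun hne => hw ((hsupp w).1 hne)
      _ = 1 := h1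

lemma pushCoord_mem (hφ : Set.InjOn φ U) (hL : DownClosed L) (hU : ∀ s ∈ L, s ⊆ U)
    (hKL : ∀ M, M ∈ K ↔ ∃ s ∈ L, s.image φ = M) {x : α → ℝ} (hx : x ∈ geom L) :
    pushCoord φ U x ∈ realization K := by
  obtain ⟨s, hs, h0, hout, hsum⟩ := hx
  have hsU := hU s hs
  refine ⟨fun w => sum_nonneg fun v _ => h0 v, ?_, {v ∈ s | x v ≠ 0}.image φ,
    (hKL _).2 ⟨_, hL s hs _ (filter_subset _ _) ?_, rfl⟩, fun w => ⟨fun hw => ?_, fun hw => ?_⟩⟩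
  · calc ∑ w, pushCoord φ U x w = ∑ v ∈ U, x v := sum_fiberwise U φ x
      _ = ∑ v ∈ s, x v := (sum_subset hsU fun v _ hv => hout v hv).symm
      _ = 1 := hsum
  · obtain ⟨v, hv, hne⟩ := exists_ne_zero_of_sum_ne_zero (hsum.trans_ne one_ne_zero)
    exact ⟨v, mem_filter.2 ⟨hv, hne⟩⟩
  · obtain ⟨v, hv, hne⟩ := exists_ne_zero_of_sum_ne_zero hw
    exact mem_image.2 ⟨v, mem_filter.2 ⟨not_not.1 fun h => hne (hout v h), hne⟩,
      (mem_filter.1 hv).2⟩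
  · obtain ⟨v, hv, rfl⟩ := mem_image.1 hw
    rw [mem_filter] at hv
    rw [pushCoord_apply hφ x (hsU hv.1)]
    exact hv.2

/-- The realization of `K` and the one of `L` agree if `φ` identifies the faces of `L` with the
faces of `K`. -/
def realizationHomeomorph [DecidableEq α] (hφ : Set.InjOn φ U) (hL : DownClosed L)
    (hU : ∀ s ∈ L, s ⊆ U)
    (hKL : ∀ M, M ∈ K ↔ ∃ s ∈ L, s.image φ = M) : realization K ≃ₜ geom L where
  toFun y := ⟨pullCoord φ U y, pullCoord_mem hφ hU hKL y.2⟩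
  invFun x := ⟨pushCoord φ U x, pushCoord_mem hφ hL hU hKL x.2⟩
  left_inv := by
    rintro ⟨y, -, -, M, hM, hsupp⟩
    obtain ⟨s, hs, rfl⟩ := (hKL M).1 hM
    refine Subtype.ext (funext fun w => ?_)
    by_cases hw : ∃ v ∈ U, φ v = w
    · obtain ⟨v, hv, rfl⟩ := hw
      exact (pushCoord_apply hφ _ hv).trans (if_pos hv)
    · push Not at hw
      refine (pushCoord_eq_zero _ hw).trans (not_not.1 fun hne => ?_)
      obtain ⟨v, hv, hvw⟩ := mem_image.1 ((hsupp w).1 (Ne.symm hne))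
      exact hw v (hU s hs hv) hvw
  right_inv := by
    rintro ⟨x, s, hs, -, hout, -⟩
    refine Subtype.ext (funext fun v => ?_)
    by_cases hv : v ∈ U
    · exact (if_pos hv).trans (pushCoord_apply hφ x hv)
    · exact (if_neg hv).trans (hout v fun h => hv (hU s hs h)).symm
  continuous_toFun := (continuous_pullCoord.comp continuous_subtype_val).subtype_mk _
  continuous_invFun := (continuous_pushCoord.comp continuous_subtype_val).subtype_mk _

end Comparison

/-! ### Maximal Morse matchings on a cycle -/

section Bridge

open Label

/-- The `E`-labels of `s` lie at distance less than `k` from `a`, and the successors of the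
`O`-labels lie at distance at least `k`, but not directly before `a`. -/
def Separated (n a k : ℕ) (s : Finset Label) : Prop :=
  (∀ x, E x ∈ s → off n a x < k) ∧
    ∀ y, O y ∈ s → k ≤ off n a (adv n y 1) ∧ off n a (adv n y 1) + 1 < n

lemma off_adv_one {n a y : ℕ} (ha : a < n) (hy : y < n) (h : off n a y + 1 < n) :
    off n a (adv n y 1) = off n a y + 1 := by
  unfold off adv at *
  split_ifs at * <;> omega

lemma off_adv_one_eq_zero {n a y : ℕ} (ha : a < n) (hy : y < n) (h : off n a y + 1 = n) :
    off n a (adv n y 1) = 0 := by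
  unfold off adv at *
  split_ifs at * <;> omega

lemma adv_one_pred {n i : ℕ} (hi : i < n) : adv n (adv n i (n - 1)) 1 = i := by
  unfold adv
  split_ifs <;> omega

lemma off_rebase {n a c x : ℕ} (ha : a < n) (hc : c < n) (hx : x < n)
    (h : off n a c ≤ off n a x) : off n c x = off n a x - off n a c := by
  unfold off at *
  split_ifs at * <;> omega

lemma exists_separated_of_mem_cyc {n : ℕ} (hn : 4 ≤ n) {s : Finset Label}
    (hs : s ∈ cyc n (n - 3)) : ∃ a < n, ∃ k < n, Separated n a k s := by
  obtain ⟨hv, -, ⟨hO, i, hi, his⟩ | ⟨hE, i, hi, his⟩ | ⟨⟨b, hb⟩, a, ha, h⟩⟩ := hs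
  · refine ⟨adv n i 1, adv_lt hi (by omega), n - 1, by omega, fun x hx => ?_,
      fun y hy => absurd hy (hO y)⟩
    have hxn := hv.lt_E hx
    have hxi : x ≠ i := fun h => his (h ▸ hx)
    unfold off adv
    split_ifs <;> omega
  · refine ⟨adv n (adv n i 1) 1, adv_lt (adv_lt hi (by omega)) (by omega), 0, by omega,
      fun x hx => absurd hx (hE x), fun y hy => ⟨Nat.zero_le _, ?_⟩⟩
    have hyn := hv.lt_O hy
    have hyi : y ≠ i := fun h => his (h ▸ hy)
    unfold off adv
    split_ifs <;> omega
  · have han := hv.lt_E ha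
    obtain ⟨c, hc, hmax⟩ := exists_max_image ((range n).filter fun x => E x ∈ s) (off n a)
      ⟨a, mem_filter.2 ⟨mem_range.2 han, ha⟩⟩
    rw [mem_filter, mem_range] at hc
    have hcb := h _ _ hc.2 hb
    refine ⟨a, han, off n a c + 1, by omega, fun x hx => ?_, fun y hy => ?_⟩
    · exact Nat.lt_succ_of_le (hmax x (mem_filter.2 ⟨mem_range.2 (hv.lt_E hx), hx⟩))
    · have hcy := h _ _ hc.2 hy
      rw [off_adv_one han (hv.lt_O hy) (by omega)]
      omega

lemma mem_cyc_of_separated {n : ℕ} {s : Finset Label} (hv : Valid n s)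
    (hne : s.Nonempty) {a k : ℕ} (ha : a < n) (hk : k < n) (hs : Separated n a k s) :
    s ∈ cyc n (n - 3) := by
  refine ⟨hv, hne, ?_⟩
  by_cases hO : ∃ y, O y ∈ s
  · by_cases hE : ∃ x, E x ∈ s
    · obtain ⟨x, hx⟩ := hE
      obtain ⟨c, hc, hmin⟩ := exists_min_image ((range n).filter fun x => E x ∈ s) (off n a)
        ⟨x, mem_filter.2 ⟨mem_range.2 (hv.lt_E hx), hx⟩⟩
      rw [mem_filter, mem_range] at hc
      refine Or.inr (Or.inr ⟨hO, c, hc.2, fun x y hx hy => ?_⟩)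
      have hxn := hv.lt_E hx
      have hyn := hv.lt_O hy
      have hcx := hmin x (mem_filter.2 ⟨mem_range.2 hxn, hx⟩)
      have hxk := hs.1 x hx
      have hyk := hs.2 y hy
      have hlt := off_lt ha hyn
      have hy1 : off n a y + 1 < n := by
        by_contra hge
        rw [off_adv_one_eq_zero ha hyn (by omega)] at hyk
        omega
      rw [off_adv_one ha hyn hy1] at hyk
      rw [off_rebase ha hc.1 hxn hcx, off_rebase ha hc.1 hyn (by omega)]
      omega
    · push Not at hE
      refine Or.inr (Or.inl ⟨hE, adv n (adv n a (n - 1)) (n - 1),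
        adv_lt (adv_lt ha (by omega)) (by omega), fun h => ?_⟩)
      have := (hs.2 _ h).2
      rw [adv_one_pred (adv_lt ha (by omega)), off_adv ha (by omega)] at this
      omega
  · push Not at hO
    refine Or.inl ⟨hO, adv n a (n - 1), adv_lt ha (by omega), fun h => ?_⟩
    have := hs.1 _ h
    rw [off_adv ha (by omega)] at this
    omega

variable {n : ℕ} [NeZero n]

/-- The matching of the cycle in which, counting from `a`, the first `k` edges are matched with
their initial nodes and all others but the last with their terminal nodes. -/
def blockMatching (n : ℕ) [NeZero n] (a k : ℕ) : Finset (Finset (Fin n) × Finset (Fin n)) :=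
  ((range n).filter fun i => off n a i < k).image (fwdArc n) ∪
    ((range n).filter fun i => k ≤ off n a i ∧ off n a i + 1 < n).image (bwdArc n)

lemma mem_blockMatching {a k : ℕ} {p : Finset (Fin n) × Finset (Fin n)} :
    p ∈ blockMatching n a k ↔ ∃ i < n, (p = fwdArc n i ∧ off n a i < k) ∨
      (p = bwdArc n i ∧ k ≤ off n a i ∧ off n a i + 1 < n) := by
  simp only [blockMatching, mem_union, mem_image, mem_filter, mem_range]
  constructor
  · rintro (⟨i, ⟨hi, h⟩, rfl⟩ | ⟨i, ⟨hi, h⟩, rfl⟩)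
    · exact ⟨i, hi, Or.inl ⟨rfl, h⟩⟩
    · exact ⟨i, hi, Or.inr ⟨rfl, h⟩⟩
  · rintro ⟨i, hi, ⟨rfl, h⟩ | ⟨rfl, h⟩⟩
    · exact Or.inl ⟨i, ⟨hi, h⟩, rfl⟩
    · exact Or.inr ⟨i, ⟨hi, h⟩, rfl⟩

lemma fwdArc_mem_blockMatching (hn : 4 ≤ n) {a k i : ℕ} (hi : i < n) :
    fwdArc n i ∈ blockMatching n a k ↔ off n a i < k := by
  rw [mem_blockMatching]
  constructor
  · rintro ⟨j, hj, ⟨h, hlt⟩ | ⟨h, -⟩⟩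
    · rwa [edge_inj hn hi hj (congrArg Prod.fst h)]
    · exact absurd h (fwdArc_ne_bwdArc hn hi hj)
  · exact fun h => ⟨i, hi, Or.inl ⟨rfl, h⟩⟩

lemma bwdArc_mem_blockMatching (hn : 4 ≤ n) {a k i : ℕ} (hi : i < n) :
    bwdArc n i ∈ blockMatching n a k ↔ k ≤ off n a i ∧ off n a i + 1 < n := by
  rw [mem_blockMatching]
  constructor
  · rintro ⟨j, hj, ⟨h, -⟩ | ⟨h, hlt⟩⟩
    · exact absurd h.symm (fwdArc_ne_bwdArc hn hj hi)
    · have h1 : (bwdArc n i).1 = (bwdArc n j).1 := congrArg Prod.fst h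
      rwa [edge_inj hn hi hj h1]
  · exact fun h => ⟨i, hi, Or.inr ⟨rfl, h⟩⟩

lemma edge_ne_node (hn : 4 ≤ n) {i : ℕ} (hi : i < n) (v : Fin n) : (fwdArc n i).1 ≠ {v} := by
  intro h
  have hc := congrArg card h
  simp only [fwdArc] at hc
  rw [card_singleton, card_pair (ofNat_ne_ofNat_adv hn hi)] at hc
  omega

lemma isMatchingPairs_blockMatching (hn : 4 ≤ n) {a k : ℕ} (ha : a < n) :
    IsMatchingPairs (blockMatching n a k : Set (Finset (Fin n) × Finset (Fin n))) := by
  intro p hpM q hqM hpq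
  obtain ⟨i, hi, hp⟩ := mem_blockMatching.1 (mem_coe.1 hpM)
  obtain ⟨j, hj, hq⟩ := mem_blockMatching.1 (mem_coe.1 hqM)
  have hi' : adv n i 1 < n := adv_lt hi (by omega)
  have hj' : adv n j 1 < n := adv_lt hj (by omega)
  have hij : i ≠ j := by
    rintro rfl
    rcases hp with ⟨rfl, hp⟩ | ⟨rfl, hp⟩ <;> rcases hq with ⟨rfl, hq⟩ | ⟨rfl, hq⟩ <;>
      first | exact hpq rfl | omega
  have hp1 : p.1 = (fwdArc n i).1 := by rcases hp with ⟨rfl, -⟩ | ⟨rfl, -⟩ <;> rfl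
  have hq1 : q.1 = (fwdArc n j).1 := by rcases hq with ⟨rfl, -⟩ | ⟨rfl, -⟩ <;> rfl
  have hp2 : ∃ v, p.2 = {v} := by rcases hp with ⟨rfl, -⟩ | ⟨rfl, -⟩ <;> exact ⟨_, rfl⟩
  have hq2 : ∃ v, q.2 = {v} := by rcases hq with ⟨rfl, -⟩ | ⟨rfl, -⟩ <;> exact ⟨_, rfl⟩
  refine ⟨fun h => hij (edge_inj hn hi hj (by rw [← hp1, h, hq1])), fun h => ?_, fun h => ?_,
    fun h => ?_⟩
  · obtain ⟨v, hv⟩ := hq2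
    exact edge_ne_node hn hi v (by rw [← hp1, h, hv])
  · obtain ⟨v, hv⟩ := hp2
    exact edge_ne_node hn hj v (by rw [← hq1, ← h, hv])
  · rcases hp with ⟨rfl, hp⟩ | ⟨rfl, hp⟩ <;> rcases hq with ⟨rfl, hq⟩ | ⟨rfl, hq⟩
    · exact hij (ofNat_inj hi hj (singleton_injective h))
    · have := ofNat_inj hi hj' (singleton_injective h)
      rw [this, off_adv_one ha hj hq.2] at hp
      omega
    · have := ofNat_inj hi' hj (singleton_injective h)
      rw [← this, off_adv_one ha hi hp.2] at hq
      omega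
    · have := ofNat_inj hi' hj' (singleton_injective h)
      unfold adv at this
      split_ifs at this <;> omega

/-- A rank function decreasing along the steps of the block matching. -/
def blockRank (n : ℕ) [NeZero n] (a k : ℕ) (s : Finset (Fin n)) : ℕ :=
  if s = (fwdArc n (adv n a (n - 1))).1 then 2 * n + 1
  else (∑ v ∈ s, 2 * (off n a v - k + (k - off n a v))) / s.card

lemma blockRank_node (hn : 4 ≤ n) {a k i : ℕ} (ha : a < n) (hi : i < n) :
    blockRank n a k {Fin.ofNat n i} = 2 * (off n a i - k + (k - off n a i)) := by
  have h : (Fin.ofNat n i).val = i := Nat.mod_eq_of_lt hi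
  rw [blockRank, if_neg (edge_ne_node hn (adv_lt ha (by omega)) _).symm, sum_singleton,
    card_singleton, Nat.div_one, h]

lemma blockRank_edge (hn : 4 ≤ n) {a k i : ℕ} (ha : a < n) (hi : i < n)
    (h : off n a i + 1 < n) : blockRank n a k (fwdArc n i).1 =
      off n a i - k + (k - off n a i) + (off n a i + 1 - k + (k - (off n a i + 1))) := by
  have hi' : adv n i 1 < n := adv_lt hi (by omega)
  have h1 : (Fin.ofNat n i).val = i := Nat.mod_eq_of_lt hi
  have h2 : (Fin.ofNat n (adv n i 1)).val = adv n i 1 := Nat.mod_eq_of_lt hi'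
  have hne := ofNat_ne_ofNat_adv hn hi
  rw [blockRank, if_neg]
  · simp only [fwdArc]
    rw [sum_pair hne, card_pair hne, h1, h2, off_adv_one ha hi h]
    omega
  · intro he
    rw [edge_inj hn hi (adv_lt ha (by omega)) he, off_adv ha (by omega)] at h
    omega

lemma blockRank_last_edge {a k i : ℕ} (ha : a < n) (hi : i < n)
    (h : off n a i + 1 = n) : blockRank n a k (fwdArc n i).1 = 2 * n + 1 := by
  have : i = adv n a (n - 1) := by rw [← adv_off ha hi, show off n a i = n - 1 by omega]
  rw [blockRank, if_pos (by rw [this])]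

lemma blockRank_lt_of_morseStep (hn : 4 ≤ n) {a k : ℕ} (ha : a < n) (hk : k < n)
    {x y : Finset (Fin n)} (h : MorseStep (graphComplex (SimpleGraph.cycleGraph n))
      (blockMatching n a k : Set (Finset (Fin n) × Finset (Fin n))) x y) :
    blockRank n a k y < blockRank n a k x := by
  rcases h with ⟨harc, hM⟩ | ⟨hM, -⟩
  · rw [mem_coe] at hM
    obtain ⟨i, hi, h | h⟩ := (hasseArc_cycle_iff hn).1 harc
    · rw [h, fwdArc_mem_blockMatching hn hi] at hM
      obtain ⟨rfl, rfl⟩ := Prod.mk.inj h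
      have hlt := off_lt ha hi
      rw [blockRank_node hn ha hi]
      change _ < blockRank n a k (fwdArc n i).1
      rcases Nat.lt_or_ge (off n a i + 1) n with hc | hc
      · rw [blockRank_edge hn ha hi hc]
        omega
      · rw [blockRank_last_edge ha hi (by omega)]
        omega
    · rw [h, bwdArc_mem_blockMatching hn hi] at hM
      obtain ⟨rfl, rfl⟩ := Prod.mk.inj h
      have hlt := off_lt ha hi
      rw [blockRank_node hn ha (adv_lt hi (by omega))]
      change _ < blockRank n a k (fwdArc n i).1
      rcases Nat.lt_or_ge (off n a i + 1) n with hc | hc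
      · rw [blockRank_edge hn ha hi hc, off_adv_one ha hi hc]
        omega
      · rw [blockRank_last_edge ha hi (by omega), off_adv_one_eq_zero ha hi (by omega)]
        omega
  · rw [mem_coe] at hM
    obtain ⟨i, hi, ⟨h, hlt⟩ | ⟨h, hlt⟩⟩ := mem_blockMatching.1 hM
    · obtain ⟨rfl, rfl⟩ := Prod.mk.inj h
      rw [blockRank_node hn ha hi]
      change blockRank n a k (fwdArc n i).1 < _
      rw [blockRank_edge hn ha hi (by omega)]
      omega
    · obtain ⟨rfl, rfl⟩ := Prod.mk.inj h
      rw [blockRank_node hn ha (adv_lt hi (by omega))]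
      change blockRank n a k (fwdArc n i).1 < _
      rw [blockRank_edge hn ha hi hlt.2, off_adv_one ha hi hlt.2]
      omega

lemma isMorseMatching_blockMatching (hn : 4 ≤ n) {a k : ℕ} (ha : a < n) (hk : k < n) :
    IsMorseMatching (graphComplex (SimpleGraph.cycleGraph n))
      (blockMatching n a k : Set (Finset (Fin n) × Finset (Fin n))) := by
  refine ⟨fun p hp => ?_, isMatchingPairs_blockMatching hn ha, fun s hs => ?_⟩
  · obtain ⟨i, hi, h⟩ := mem_blockMatching.1 (mem_coe.1 hp)
    exact (hasseArc_cycle_iff hn).2 ⟨i, hi, h.imp And.left And.left⟩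
  · have : ∀ {x y}, Relation.TransGen (MorseStep (graphComplex (SimpleGraph.cycleGraph n))
        (blockMatching n a k : Set (Finset (Fin n) × Finset (Fin n)))) x y →
        blockRank n a k y < blockRank n a k x := by
      intro x y h
      induction h with
      | single h => exact blockRank_lt_of_morseStep hn ha hk h
      | tail _ h ih => exact (blockRank_lt_of_morseStep hn ha hk h).trans ih
    exact (this hs).false

lemma card_blockMatching (hn : 4 ≤ n) {a k : ℕ} (ha : a < n) (hk : k < n) :
    n - 1 ≤ (blockMatching n a k).card := by
  rw [← card_matchedEdges hn (isMorseMatching_blockMatching hn ha hk)]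
  calc n - 1 = ((range n).erase (adv n a (n - 1))).card := by
        rw [card_erase_of_mem (mem_range.2 (adv_lt ha (by omega))), card_range]
    _ ≤ _ := card_le_card fun i hi => ?_
  rw [mem_erase, mem_range] at hi
  refine mem_filter.2 ⟨mem_range.2 hi.2, ?_⟩
  rw [fwdArc_mem_blockMatching hn hi.2, bwdArc_mem_blockMatching hn hi.2]
  have h1 := off_lt ha hi.2
  have h2 : off n a i ≠ n - 1 := fun h => hi.1 (by rw [← h, adv_off ha hi.2])
  omega

lemma mem_morseComplex {V : Type} [Fintype V] [DecidableEq V] {K : Finset (Finset V)}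
    {M : Finset (Finset V × Finset V)} :
    M ∈ morseComplex K ↔ M.Nonempty ∧ IsMorseMatching K (M : Set (Finset V × Finset V)) := by
  simp [morseComplex]

lemma mem_pureMorseComplex {V : Type} [Fintype V] [DecidableEq V] {K : Finset (Finset V)}
    {M : Finset (Finset V × Finset V)} :
    M ∈ pureMorseComplex K ↔ M.Nonempty ∧ ∃ M' ∈ morseComplex K,
      (∀ N ∈ morseComplex K, N.card ≤ M'.card) ∧ M ⊆ M' := by
  simp [pureMorseComplex]

lemma blockMatching_mem_morseComplex (hn : 4 ≤ n) {a k : ℕ} (ha : a < n) (hk : k < n) :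
    blockMatching n a k ∈ morseComplex (graphComplex (SimpleGraph.cycleGraph n)) := by
  have := card_blockMatching hn ha hk
  exact mem_morseComplex.2 ⟨card_pos.1 (by omega), isMorseMatching_blockMatching hn ha hk⟩

/-- The faces of the pure Morse complex of a cycle are the nonempty subsets of block
matchings. -/
lemma mem_pureMorseComplex_cycle_iff (hn : 4 ≤ n) {M : Finset (Finset (Fin n) × Finset (Fin n))} :
    M ∈ pureMorseComplex (graphComplex (SimpleGraph.cycleGraph n)) ↔
      M.Nonempty ∧ ∃ a < n, ∃ k < n, M ⊆ blockMatching n a k := by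
  rw [mem_pureMorseComplex]
  refine and_congr_right fun _ => ⟨?_, ?_⟩
  · rintro ⟨M', hM', hmax, hsub⟩
    have hMorse := (mem_morseComplex.1 hM').2
    have h0 : 0 < n := by omega
    obtain ⟨a, ha, k, hk, hf, hb⟩ := exists_block_of_card hn hMorse
      ((card_blockMatching hn h0 h0).trans (hmax _ (blockMatching_mem_morseComplex hn h0 h0)))
    refine ⟨a, ha, k, hk, fun p hp => ?_⟩
    obtain ⟨i, hi, h⟩ := (hasseArc_cycle_iff hn).1 (hMorse.1 p (hsub hp))
    refine mem_blockMatching.2 ⟨i, hi, h.imp (fun h => ⟨h, ?_⟩) fun h => ⟨h, ?_⟩⟩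
    · exact hf i hi (h ▸ hsub hp)
    · exact hb i hi (h ▸ hsub hp)
  · rintro ⟨a, ha, k, hk, hsub⟩
    refine ⟨_, blockMatching_mem_morseComplex hn ha hk, fun N hN => ?_, hsub⟩
    have h1 := card_lt_of_isMorseMatching hn (mem_morseComplex.1 hN).2
    have h2 := card_blockMatching hn ha hk
    omega

/-- The arc of the Hasse diagram of the cycle described by a label. -/
def arcOfLabel (n : ℕ) [NeZero n] : Label → Finset (Fin n) × Finset (Fin n)
  | E i => fwdArc n i
  | O i => bwdArc n (adv n i 1)
  | P => (∅, ∅)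
  | Q => (∅, ∅)

/-- The labels of the arcs of the Hasse diagram of the cycle. -/
def cycleLabels (n : ℕ) : Finset Label := (range n).image E ∪ (range n).image O

lemma mem_cycleLabels {n : ℕ} {v : Label} : v ∈ cycleLabels n ↔ ∃ i < n, v = E i ∨ v = O i := by
  simp only [cycleLabels, mem_union, mem_image, mem_range]
  grind

lemma injOn_arcOfLabel (hn : 4 ≤ n) : Set.InjOn (arcOfLabel n) (cycleLabels n) := by
  intro u hu v hv h
  obtain ⟨i, hi, rfl | rfl⟩ := mem_cycleLabels.1 hu <;>
    obtain ⟨j, hj, rfl | rfl⟩ := mem_cycleLabels.1 hv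
  · rw [edge_inj hn hi hj (congrArg Prod.fst h)]
  · exact absurd h (fwdArc_ne_bwdArc hn hi (adv_lt hj (by omega)))
  · exact absurd h.symm (fwdArc_ne_bwdArc hn hj (adv_lt hi (by omega)))
  · have h1 : (arcOfLabel n (O i)).1 = (arcOfLabel n (O j)).1 := congrArg Prod.fst h
    have h2 := edge_inj hn (adv_lt hi (by omega)) (adv_lt hj (by omega)) h1
    congr 1
    unfold adv at h2
    split_ifs at h2 <;> omega

lemma image_arcOfLabel_subset_blockMatching (hn : 4 ≤ n) {s : Finset Label} (hs : Valid n s)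
    {a k : ℕ} : s.image (arcOfLabel n) ⊆ blockMatching n a k ↔ Separated n a k s := by
  constructor
  · refine fun h => ⟨fun x hx => ?_, fun y hy => ?_⟩
    · exact (fwdArc_mem_blockMatching hn (hs.lt_E hx)).1 (h (mem_image_of_mem _ hx))
    · exact (bwdArc_mem_blockMatching hn (adv_lt (hs.lt_O hy) (by omega))).1
        (h (mem_image_of_mem _ hy))
  · intro h p hp
    obtain ⟨v, hv, rfl⟩ := mem_image.1 hp
    obtain ⟨i, hi, rfl | rfl⟩ := hs v hv
    · exact (fwdArc_mem_blockMatching hn hi).2 (h.1 i hv)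
    · exact (bwdArc_mem_blockMatching hn (adv_lt hi (by omega))).2 (h.2 i hv)

lemma blockMatching_subset_image (hn : 4 ≤ n) (a k : ℕ) :
    blockMatching n a k ⊆ (cycleLabels n).image (arcOfLabel n) := by
  intro p hp
  obtain ⟨i, hi, ⟨rfl, -⟩ | ⟨rfl, -⟩⟩ := mem_blockMatching.1 hp
  · exact mem_image.2 ⟨E i, mem_cycleLabels.2 ⟨i, hi, Or.inl rfl⟩, rfl⟩
  · refine mem_image.2 ⟨O (adv n i (n - 1)),
      mem_cycleLabels.2 ⟨_, adv_lt hi (by omega), Or.inr rfl⟩, ?_⟩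
    rw [arcOfLabel, adv_one_pred hi]

lemma mem_pureMorseComplex_cycle_iff_exists_label (hn : 4 ≤ n)
    (M : Finset (Finset (Fin n) × Finset (Fin n))) :
    M ∈ pureMorseComplex (graphComplex (SimpleGraph.cycleGraph n)) ↔
      ∃ s ∈ cyc n (n - 3), s.image (arcOfLabel n) = M := by
  rw [mem_pureMorseComplex_cycle_iff hn]
  constructor
  · rintro ⟨hne, a, ha, k, hk, hsub⟩
    obtain ⟨s, hs, rfl⟩ := subset_image_iff.1 (hsub.trans (blockMatching_subset_image hn a k))
    have hv : Valid n s := fun v hv => mem_cycleLabels.1 (hs hv)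
    exact ⟨s, mem_cyc_of_separated hv (image_nonempty.1 hne) ha hk
      ((image_arcOfLabel_subset_blockMatching hn hv).1 hsub), rfl⟩
  · rintro ⟨s, hs, rfl⟩
    obtain ⟨a, ha, k, hk, h⟩ := exists_separated_of_mem_cyc hn hs
    exact ⟨hs.2.1.image _, a, ha, k, hk, (image_arcOfLabel_subset_blockMatching hn hs.1).2 h⟩

end Bridge

/-- for `n ≥ 4`, the pure discrete Morse complex of the cycle graph `C_n`
is homotopy equivalent to `S² ∨ S^(n-2) ∨ S^(n-2)`. -/
theorem pure_morse_complex_cycle_homotopy_type (n : ℕ) (hn : 4 ≤ n) :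
    ∃ (p : NSphere 2) (q₁ q₂ : NSphere (n - 2)),
      Nonempty (ContinuousMap.HomotopyEquiv
        (↥(realization (pureMorseComplex (graphComplex (SimpleGraph.cycleGraph n)))))
        (Wedge3 (NSphere 2) (NSphere (n - 2)) (NSphere (n - 2)) p q₁ q₂)) := by
  have : NeZero n := ⟨by omega⟩
  obtain ⟨p, q₁, q₂, ⟨f⟩⟩ := geom_cyc_homotopyEquiv_wedge hn
  have e := realizationHomeomorph (injOn_arcOfLabel hn) (cyc_downClosed (by omega))
    (fun s hs v hv => mem_cycleLabels.2 (hs.1 v hv))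
    (mem_pureMorseComplex_cycle_iff_exists_label hn)
  exact ⟨p, q₁, q₂, ⟨e.toHomotopyEquiv.trans f⟩⟩
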